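/- arXiv:2111.04575 — 4 statements merged into one kernel-verified Lean document; each statement's English description precedes it below -/
import Mathlib

section
/- For all real numbers ξ₁, η₁, ξ₂, η₂ with (ξ₁,η₁) ≠ (0,0) and (ξ₂,η₂) ≠ (0,0), setting ξ = ξ₁ + ξ₂ and η = η₁ + η₂, one has the identity m(ξ₁,ξ₂,η₁,η₂) = (2/3) · (ξ₁ξ₂ + η₁η₂)/((ξ₁² + η₁²)(ξ₂² + η₂²)) · r(ξ₁,ξ₂,η₁,η₂). -/
/-- The resonance function of the Novikov-Veselov equation. -/
def rNV (ξ₁ ξ₂ η₁ η₂ : ℝ) : ℝ :=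
  3 * ((ξ₁ + ξ₂) * (ξ₁ * ξ₂ - η₁ * η₂) - (η₁ + η₂) * (ξ₁ * η₂ + ξ₂ * η₁))

/-- The bilinear Fourier multiplier of the Novikov-Veselov nonlinearity. -/
noncomputable def mNV (ξ₁ ξ₂ η₁ η₂ : ℝ) : ℝ :=
  (ξ₁ + ξ₂) * ((ξ₁ ^ 2 - η₁ ^ 2) / (ξ₁ ^ 2 + η₁ ^ 2) + (ξ₂ ^ 2 - η₂ ^ 2) / (ξ₂ ^ 2 + η₂ ^ 2))
    - (η₁ + η₂) * (2 * ξ₁ * η₁ / (ξ₁ ^ 2 + η₁ ^ 2) + 2 * ξ₂ * η₂ / (ξ₂ ^ 2 + η₂ ^ 2))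

theorem sq_add_sq_ne_zero_of_ne {x y : ℝ} (h : (x, y) ≠ ((0 : ℝ), (0 : ℝ))) :
    x ^ 2 + y ^ 2 ≠ 0 := by
  contrapose! h
  have hx : x = 0 := by nlinarith [sq_nonneg x, sq_nonneg y]
  have hy : y = 0 := by nlinarith [sq_nonneg x, sq_nonneg y]
  rw [hx, hy]

/-- The multiplier `m` factors through the resonance function `r`. -/
theorem multiplier_eq_resonance (ξ₁ η₁ ξ₂ η₂ : ℝ)
    (h₁ : (ξ₁, η₁) ≠ ((0 : ℝ), (0 : ℝ))) (h₂ : (ξ₂, η₂) ≠ ((0 : ℝ), (0 : ℝ))) :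
    mNV ξ₁ ξ₂ η₁ η₂ =
      2 / 3 * ((ξ₁ * ξ₂ + η₁ * η₂) / ((ξ₁ ^ 2 + η₁ ^ 2) * (ξ₂ ^ 2 + η₂ ^ 2)))
        * rNV ξ₁ ξ₂ η₁ η₂ := by
  have hz := sq_add_sq_ne_zero_of_ne h₁
  have hw := sq_add_sq_ne_zero_of_ne h₂
  unfold mNV rNV
  field_simp
  ring
end

section
/- For all real numbers ξ₁, η₁, ξ₂, η₂ with (ξ₁,η₁) ≠ (0,0) and (ξ₂,η₂) ≠ (0,0), one has |m(ξ₁,ξ₂,η₁,η₂)| ≤ |r(ξ₁,ξ₂,η₁,η₂)| / (|(ξ₁,η₁)| · |(ξ₂,η₂)|), where |(a,b)| = √(a² + b²) denotes the Euclidean norm. -/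
/-- The Euclidean norm of a pair of reals. -/
noncomputable def enorm2 (a b : ℝ) : ℝ := Real.sqrt (a ^ 2 + b ^ 2)

theorem sq_add_sq_pos_of_ne_zero {a b : ℝ} (h : (a, b) ≠ ((0 : ℝ), (0 : ℝ))) :
    0 < a ^ 2 + b ^ 2 := by
  refine lt_of_le_of_ne (by positivity) fun h0 => h (Prod.ext ?_ ?_)
  · exact pow_eq_zero_iff two_ne_zero |>.1 (by nlinarith [sq_nonneg a, sq_nonneg b])
  · exact pow_eq_zero_iff two_ne_zero |>.1 (by nlinarith [sq_nonneg a, sq_nonneg b])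

/-- The multiplier equals the resonance function times `2/3` of the inner product of the two
frequencies, divided by the product of their squared norms. -/
theorem mNV_eq_inner_mul_rNV {ξ₁ η₁ ξ₂ η₂ : ℝ} (h₁ : ξ₁ ^ 2 + η₁ ^ 2 ≠ 0)
    (h₂ : ξ₂ ^ 2 + η₂ ^ 2 ≠ 0) :
    mNV ξ₁ ξ₂ η₁ η₂ = 2 / 3 * (ξ₁ * ξ₂ + η₁ * η₂) * rNV ξ₁ ξ₂ η₁ η₂ /
      ((ξ₁ ^ 2 + η₁ ^ 2) * (ξ₂ ^ 2 + η₂ ^ 2)) := by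
  unfold mNV rNV
  field_simp
  ring

/-- The Cauchy-Schwarz inequality in the plane. -/
theorem abs_inner_le_enorm2_mul (a b c d : ℝ) :
    |a * c + b * d| ≤ enorm2 a b * enorm2 c d := by
  unfold enorm2
  rw [← Real.sqrt_mul (by positivity)]
  exact Real.abs_le_sqrt (by nlinarith [sq_nonneg (a * d - b * c)])

/-- `|m| ≤ |r| / (|(ξ₁,η₁)|·|(ξ₂,η₂)|)`. -/
theorem multiplier_bound (ξ₁ η₁ ξ₂ η₂ : ℝ)
    (h₁ : (ξ₁, η₁) ≠ ((0 : ℝ), (0 : ℝ))) (h₂ : (ξ₂, η₂) ≠ ((0 : ℝ), (0 : ℝ))) :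
    |mNV ξ₁ ξ₂ η₁ η₂| ≤ |rNV ξ₁ ξ₂ η₁ η₂| / (enorm2 ξ₁ η₁ * enorm2 ξ₂ η₂) := by
  have p₁ := sq_add_sq_pos_of_ne_zero h₁
  have p₂ := sq_add_sq_pos_of_ne_zero h₂
  have hN : 0 < enorm2 ξ₁ η₁ * enorm2 ξ₂ η₂ := mul_pos (Real.sqrt_pos.2 p₁) (Real.sqrt_pos.2 p₂)
  have hsq : (ξ₁ ^ 2 + η₁ ^ 2) * (ξ₂ ^ 2 + η₂ ^ 2) = (enorm2 ξ₁ η₁ * enorm2 ξ₂ η₂) ^ 2 := by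
    rw [mul_pow, enorm2, enorm2, Real.sq_sqrt p₁.le, Real.sq_sqrt p₂.le]
  have hCS := abs_inner_le_enorm2_mul ξ₁ η₁ ξ₂ η₂
  rw [mNV_eq_inner_mul_rNV p₁.ne' p₂.ne', hsq, abs_div, abs_mul, abs_mul, abs_of_pos (pow_pos hN 2),
    abs_of_pos (by norm_num : (0 : ℝ) < 2 / 3), div_le_div_iff₀ (pow_pos hN 2) hN]
  generalize enorm2 ξ₁ η₁ * enorm2 ξ₂ η₂ = N at *
  calc 2 / 3 * |ξ₁ * ξ₂ + η₁ * η₂| * |rNV ξ₁ ξ₂ η₁ η₂| * N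
      ≤ N * |rNV ξ₁ ξ₂ η₁ η₂| * N := by
        gcongr
        linarith [abs_nonneg (ξ₁ * ξ₂ + η₁ * η₂)]
    _ = |rNV ξ₁ ξ₂ η₁ η₂| * N ^ 2 := by ring
end

section
/- For every ε > 0 there exists a constant c(ε) > 0 such that for all (ξ₁, η₁) ∈ ℤ², every R ≥ 1 and all a₀, b₀ ∈ ℝ, the number of pairs (ξ, η) ∈ ℤ² with a₀ ≤ ξ ≤ a₀ + 2R and b₀ ≤ η ≤ b₀ + 2R, not satisfying ξ = 0 and ξ₁ = 0 simultaneously, for which (x + 2ξ₁)(x² − y²) = 2(y + 2η₁)xy holds with x = ξ − 2ξ₁ and y = η − 2η₁, is at most c(ε)·R^{3/5 + ε}. -/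
/-- A cubic equation with a linear part that is invertible in `v` determines `v` modulo `P ^ 3`
as a polynomial in `u`. -/
theorem exists_adic_expansion (P α β A B C γ h : ℤ) (hγ : γ * β = 1 + P ^ 3 * h) :
    ∃ f₁ f₂ f₃ : ℤ, ∀ u v : ℤ,
      β * v + α * u + P * (A * u ^ 2 + B * u * v + C * v ^ 2) +
        P ^ 2 * (u ^ 3 - 3 * u * v ^ 2) = 0 →
      ∃ t, v = f₁ * u + P * (f₂ * u ^ 2) + P ^ 2 * (f₃ * u ^ 3 + P * t) := by
  obtain ⟨f₁, hf₁⟩ : ∃ f₁, f₁ = -γ * α := ⟨_, rfl⟩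
  obtain ⟨f₂, hf₂⟩ : ∃ f₂, f₂ = -γ * (A + B * f₁ + C * f₁ ^ 2) := ⟨_, rfl⟩
  obtain ⟨f₃, hf₃⟩ : ∃ f₃, f₃ = -γ * ((B + 2 * C * f₁) * f₂ + 1 - 3 * f₁ ^ 2) := ⟨_, rfl⟩
  refine ⟨f₁, f₂, f₃, fun u v huv => ?_⟩
  obtain ⟨t₁, ht₁⟩ : ∃ t₁, t₁ = -γ * ((A * u ^ 2 + B * u * v + C * v ^ 2) +
    P * (u ^ 3 - 3 * u * v ^ 2)) - P ^ 2 * h * v := ⟨_, rfl⟩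
  have h₁ : v = f₁ * u + P * t₁ := by
    rw [hf₁, ht₁]; linear_combination γ * huv - v * hγ
  obtain ⟨t₂, ht₂⟩ : ∃ t₂, t₂ = -γ * ((B + 2 * C * f₁) * u * t₁ + P * C * t₁ ^ 2) -
    γ * (u ^ 3 - 3 * u * v ^ 2) - P * h * v := ⟨_, rfl⟩
  have h₂ : t₁ = f₂ * u ^ 2 + P * t₂ := by
    rw [hf₂, ht₂]
    linear_combination ht₁ - γ * (B * u + C * (v + f₁ * u + P * t₁)) * h₁
  refine ⟨-γ * (B + 2 * C * f₁) * u * t₂ - γ * C * t₁ ^ 2 + 3 * γ * u * t₁ * (v + f₁ * u) -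
    h * v, ?_⟩
  rw [hf₃]
  linear_combination h₁ + P * h₂ + P ^ 2 * ht₂ - P ^ 2 * γ * (B + 2 * C * f₁) * u * h₂ +
    P ^ 2 * 3 * γ * u * (v + f₁ * u) * h₁

/-- The determinant of the monomials `1, X, X², Y, XY` at five points in one residue class modulo
`P`, on a branch expanded as in `exists_adic_expansion`, is divisible by `P ^ 10`. -/
theorem prime_pow_dvd_det (P : ℕ) [Fact P.Prime] (X₀ Y₀ f₁ f₂ f₃ : ℤ) (u v t : Fin 5 → ℤ)
    (hv : ∀ i, v i = f₁ * u i + P * (f₂ * u i ^ 2) + P ^ 2 * (f₃ * u i ^ 3 + P * t i)) :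
    (P : ℤ) ^ 10 ∣ Matrix.det (Matrix.of fun i =>
      ![1, X₀ + P * u i, (X₀ + P * u i) ^ 2, Y₀ + P * v i,
        (X₀ + P * u i) * (Y₀ + P * v i)]) := by
  let W : Matrix (Fin 5) (Fin 5) ℤ := Matrix.of fun i =>
    ![1, u i, u i ^ 2, f₃ * u i ^ 3 + P * t i,
      f₂ * u i ^ 3 + P * (u i * (f₃ * u i ^ 3 + P * t i))]
  let S : Matrix (Fin 5) (Fin 5) ℤ := !![1, X₀, X₀ ^ 2, Y₀, X₀ * Y₀;
    0, (P : ℤ), 2 * X₀ * P, P * f₁, X₀ * P * f₁ + Y₀ * P;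
    0, 0, (P : ℤ) ^ 2, P ^ 2 * f₂, X₀ * P ^ 2 * f₂ + P ^ 2 * f₁;
    0, 0, 0, (P : ℤ) ^ 3, X₀ * P ^ 3;
    0, 0, 0, 0, (P : ℤ) ^ 3]
  have hS : S.det = (P : ℤ) ^ 9 := by
    rw [Matrix.det_of_isUpperTriangular]
    · simp [S, Fin.prod_univ_succ]; ring
    · intro i j hij
      fin_cases i <;> fin_cases j <;> simp [S] at hij ⊢
  have hW : (P : ℤ) ∣ W.det := by
    rw [← ZMod.intCast_zmod_eq_zero_iff_dvd, Int.cast_det]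
    let V : Matrix (Fin 5) (Fin 5) (ZMod P) := Matrix.of fun i =>
      ![1, (u i : ZMod P), (u i : ZMod P) ^ 2, (u i : ZMod P) ^ 3, 0]
    let T : Matrix (Fin 5) (Fin 5) (ZMod P) := !![1, 0, 0, 0, 0; 0, 1, 0, 0, 0;
      0, 0, 1, 0, 0; 0, 0, 0, (f₃ : ZMod P), (f₂ : ZMod P); 0, 0, 0, 0, 0]
    have hVT : W.map (fun x : ℤ => (x : ZMod P)) = V * T := by
      ext i j
      rw [Matrix.mul_apply]
      fin_cases j <;> simp [W, V, T, Fin.sum_univ_succ] <;> ring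
    have hV : V.det = 0 := Matrix.det_eq_zero_of_column_eq_zero 4 fun i => by simp [V]
    rw [hVT, Matrix.det_mul, hV, zero_mul]
  have hM : (Matrix.of fun i => ![1, X₀ + P * u i, (X₀ + P * u i) ^ 2, Y₀ + P * v i,
        (X₀ + P * u i) * (Y₀ + P * v i)]) = W * S := by
    ext i j
    rw [Matrix.mul_apply]
    fin_cases j <;> simp [W, S, Fin.sum_univ_succ, hv] <;> ring
  rw [hM, Matrix.det_mul, hS, pow_succ' (P : ℤ) 9]
  exact mul_dvd_mul_right hW _

theorem abs_det_le (L : ℤ) (hL : 0 ≤ L) (X Y : Fin 5 → ℤ) (hX : ∀ i, 0 ≤ X i ∧ X i ≤ L)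
    (hY : ∀ i, 0 ≤ Y i ∧ Y i ≤ L) :
    |Matrix.det (Matrix.of fun i => ![1, X i, X i ^ 2, Y i, X i * Y i])| ≤ 120 * L ^ 6 := by
  let w : Fin 5 → ℤ := ![1, L, L ^ 2, L, L * L]
  have hle : ∀ i j, |(Matrix.of fun i => ![1, X i, X i ^ 2, Y i, X i * Y i]) i j| ≤ w j := by
    intro i j
    have h1 := hX i
    have h2 := hY i
    have hx : |X i| ≤ L := abs_le.2 ⟨by linarith, h1.2⟩
    have hy : |Y i| ≤ L := abs_le.2 ⟨by linarith, h2.2⟩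
    fin_cases j
    · simp [w]
    · simpa [w] using hx
    · have := pow_le_pow_left₀ (abs_nonneg _) hx 2
      simpa [w, abs_pow] using this
    · simpa [w] using hy
    · have := mul_le_mul hx hy (abs_nonneg _) hL
      simpa [w, abs_mul] using this
  rw [Matrix.det_apply']
  refine (Finset.abs_sum_le_sum_abs _ _).trans ?_
  refine (Finset.sum_le_card_nsmul _ _ (L ^ 6) fun σ _ => ?_).trans ?_
  · rw [abs_mul, Finset.abs_prod]
    have : |((Equiv.Perm.sign σ : ℤˣ) : ℤ)| = 1 := by
      rcases Int.units_eq_one_or (Equiv.Perm.sign σ) with h | h <;> simp [h]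
    simp only [Int.cast_id]
    rw [this, one_mul]
    refine (Finset.prod_le_prod (fun _ _ => abs_nonneg _) fun i _ => hle (σ i) i).trans ?_
    simp [w, Fin.prod_univ_succ]
    apply le_of_eq; ring
  · rw [Finset.card_univ, Fintype.card_perm]
    simp [Nat.factorial]

/-- Vectors any `n` of which are linearly dependent satisfy a common linear relation. -/
theorem exists_common_relation {ι : Type*} {n : ℕ} (S : Set ι) (f : ι → Fin n → ℚ)
    (hdet : ∀ p : Fin n → ι, (∀ i, p i ∈ S) → Matrix.det (Matrix.of fun i => f (p i)) = 0) :
    ∃ c : Fin n → ℚ, c ≠ 0 ∧ ∀ p ∈ S, ∑ j, c j * f p j = 0 := by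
  have hlt : Submodule.span ℚ (f '' S) < ⊤ := by
    rw [lt_top_iff_ne_top]
    intro htop
    obtain ⟨b, hbS, hspan, hli⟩ := exists_linearIndependent ℚ (f '' S)
    let e := Module.Basis.mk hli (by rw [Subtype.range_coe, hspan, htop])
    have : Fintype b := FiniteDimensional.fintypeBasisIndex e
    have hc : Fintype.card b = Fintype.card (Fin n) := by
      rw [← Module.finrank_eq_card_basis e, Module.finrank_fin_fun, Fintype.card_fin]
    let φ := (Fintype.equivOfCardEq hc).symm
    choose p hp hpf using fun i => hbS (φ i).2
    have h1 : LinearIndependent ℚ (fun i => f (p i)) := by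
      rw [funext hpf]
      exact hli.comp φ φ.injective
    have h2 := Matrix.linearIndependent_rows_iff_isUnit.1
      (show LinearIndependent ℚ (Matrix.of fun i => f (p i)).row from h1)
    rw [Matrix.isUnit_iff_isUnit_det, hdet p hp] at h2
    exact not_isUnit_zero h2
  obtain ⟨g, hg, hgS⟩ := Submodule.exists_le_ker_of_lt_top _ hlt
  refine ⟨fun j => g (Pi.single j 1), fun h => hg ?_, fun p hp => ?_⟩
  · ext j
    simpa using congrFun h j
  · have h0 : g (f p) = 0 := hgS (Submodule.subset_span ⟨p, hp, rfl⟩)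
    rw [← h0, LinearMap.pi_apply_eq_sum_univ g (f p)]
    refine Finset.sum_congr rfl fun j _ => ?_
    rw [smul_eq_mul, mul_comm]
    have : (Pi.single j 1 : Fin n → ℚ) = fun k => if j = k then 1 else 0 := by
      ext k
      simp [Pi.single_apply, eq_comm]
    simp only [this]

theorem card_le_two_of_quadratic {R : Type*} [CommRing R] [IsDomain R] (a b c : R)
    (h : ¬(a = 0 ∧ b = 0 ∧ c = 0)) (S : Finset R)
    (hS : ∀ y ∈ S, a * y ^ 2 + b * y + c = 0) : S.card ≤ 2 := by
  let p : Polynomial R := .C a * .X ^ 2 + .C b * .X + .C c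
  have hp : p ≠ 0 := by
    intro h0
    refine h ⟨?_, ?_, ?_⟩
    · simpa [p] using congrArg (fun q => q.coeff 2) h0
    · simpa [p] using congrArg (fun q => q.coeff 1) h0
    · simpa [p] using congrArg (fun q => q.coeff 0) h0
  refine (Polynomial.card_le_degree_of_subset_roots (p := p) fun y hy => ?_).trans
    Polynomial.natDegree_quadratic_le
  rw [Polynomial.mem_roots hp]
  simpa [p, Polynomial.IsRoot] using hS y hy

theorem card_le_two_mul_card_image_fst (a b : ℤ) (S : Finset (ℤ × ℤ))
    (hS : ∀ p ∈ S, p.1 ≠ 0 ∧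
      (3 * p.1 + 2 * a) * p.2 ^ 2 + 4 * b * p.1 * p.2 = p.1 ^ 2 * (p.1 + 2 * a)) :
    S.card ≤ 2 * (S.image Prod.fst).card := by
  refine Finset.card_le_mul_card_image S 2 fun x hx => ?_
  obtain ⟨p, hp, rfl⟩ := Finset.mem_image.1 hx
  rw [← Finset.card_image_of_injOn (f := Prod.snd)]
  · refine card_le_two_of_quadratic (3 * p.1 + 2 * a) (4 * b * p.1) (-(p.1 ^ 2 * (p.1 + 2 * a)))
      ?_ _ fun y hy => ?_
    · rintro ⟨h1, -, h2⟩
      have h0 := (hS p hp).1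
      have h3 : p.1 + 2 * a = 0 := by
        simpa [h0] using h2
      omega
    · obtain ⟨q, hq, rfl⟩ := Finset.mem_image.1 hy
      obtain ⟨hq, hqp⟩ := Finset.mem_filter.1 hq
      have := (hS q hq).2
      rw [hqp] at this
      linear_combination this
  · intro q hq r hr hqr
    have h1 := (Finset.mem_filter.1 hq).2
    have h2 := (Finset.mem_filter.1 hr).2
    exact Prod.ext (h1.trans h2.symm) hqr

open Polynomial in
theorem sq_ne_mul_sq (a b : ℚ) (G l : ℚ[X]) (hl : l ≠ 0) :
    G ^ 2 ≠ X ^ 2 * (C 3 * X ^ 2 + C a * X + C b) * l ^ 2 := by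
  intro h
  have h1 := congrArg leadingCoeff h
  rw [leadingCoeff_mul, leadingCoeff_mul, leadingCoeff_pow, leadingCoeff_pow, leadingCoeff_pow,
    leadingCoeff_quadratic (by norm_num), leadingCoeff_X, one_pow, one_mul] at h1
  have hl' : l.leadingCoeff ≠ 0 := leadingCoeff_ne_zero.2 hl
  have h3 : IsSquare ((3 : ℕ) : ℚ) := by
    refine ⟨G.leadingCoeff / l.leadingCoeff, ?_⟩
    field_simp
    push_cast
    linear_combination -h1
  rw [Rat.isSquare_natCast_iff] at h3
  obtain ⟨r, hr⟩ := h3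
  have : r < 2 := by nlinarith
  interval_cases r <;> omega

open Polynomial in
theorem card_le_twelve_of_relation (a b m n : ℤ) (S : Finset (ℤ × ℤ))
    (hS : ∀ p ∈ S, p.1 ≠ 0 ∧
      (3 * p.1 + 2 * a) * p.2 ^ 2 + 4 * b * p.1 * p.2 = p.1 ^ 2 * (p.1 + 2 * a))
    (c : Fin 5 → ℚ) (hc : c ≠ 0)
    (hrel : ∀ p ∈ S, c 0 + c 1 * (p.1 - m) + c 2 * (p.1 - m) ^ 2 + c 3 * (p.2 - n) +
      c 4 * ((p.1 - m) * (p.2 - n)) = 0) :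
    S.card ≤ 12 := by
  let q : ℚ[X] := C (c 0) + C (c 1) * (X - C (m : ℚ)) + C (c 2) * (X - C (m : ℚ)) ^ 2 -
    C (n : ℚ) * (C (c 3) + C (c 4) * (X - C (m : ℚ)))
  let l : ℚ[X] := C (c 3) + C (c 4) * (X - C (m : ℚ))
  have hql : ∀ p ∈ S, q.eval (p.1 : ℚ) + l.eval (p.1 : ℚ) * p.2 = 0 := fun p hp => by
    simp only [q, l, eval_add, eval_sub, eval_mul, eval_C, eval_X, eval_pow]
    linear_combination hrel p hp
  suffices ∃ f : ℚ[X], f ≠ 0 ∧ f.natDegree ≤ 6 ∧ ∀ p ∈ S, f.eval (p.1 : ℚ) = 0 by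
    obtain ⟨f, hf, hdeg, hroot⟩ := this
    have h6 : (S.image Prod.fst).card ≤ 6 := by
      rw [← Finset.card_image_of_injective _ (Int.cast_injective (α := ℚ))]
      refine (card_le_degree_of_subset_roots (p := f) fun x hx => ?_).trans hdeg
      obtain ⟨z, hz, rfl⟩ := Finset.mem_image.1 (Finset.mem_def.2 hx)
      obtain ⟨p, hp, rfl⟩ := Finset.mem_image.1 hz
      exact (mem_roots hf).2 (hroot p hp)
    have := card_le_two_mul_card_image_fst a b S hS
    omega
  by_cases hl : l = 0
  · refine ⟨q, fun hq => hc ?_, ?_, fun p hp => by simpa [hl] using hql p hp⟩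
    · have hshift : ∀ t : ℚ, c 3 + c 4 * t = 0 := fun t => by
        simpa [l] using congrArg (eval (t + m)) hl
      have hshift' : ∀ t : ℚ, c 0 + c 1 * t + c 2 * t ^ 2 = 0 := fun t => by
        simpa [q, hshift] using congrArg (eval (t + m)) hq
      ext i
      have := hshift 0
      have := hshift 1
      have := hshift' 0
      have := hshift' 1
      have := hshift' (-1)
      fin_cases i <;> simp <;> linarith
    · simp only [q]; compute_degree!
  · refine ⟨(-(C 3 * X + C (2 * a : ℚ)) * q + C (2 * b : ℚ) * X * l) ^ 2 -
      X ^ 2 * (C 3 * X ^ 2 + C (8 * a : ℚ) * X + C (4 * a ^ 2 + 4 * b ^ 2 : ℚ)) * l ^ 2,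
      sub_ne_zero.2 (sq_ne_mul_sq _ _ _ _ hl), ?_, fun p hp => ?_⟩
    · have h1 : q.natDegree ≤ 2 := by simp only [q]; compute_degree!
      have h2 : l.natDegree ≤ 1 := by simp only [l]; compute_degree!
      have h3 : (-(C 3 * X + C (2 * a : ℚ)) * q + C (2 * b : ℚ) * X * l).natDegree ≤ 3 := by
        refine natDegree_add_le_of_degree_le (natDegree_mul_le_of_le (m := 1) ?_ h1)
          ((natDegree_mul_le_of_le (m := 1) ?_ h2).trans (by norm_num)) <;> compute_degree!
      refine natDegree_sub_le_of_le (natDegree_pow_le_of_le 2 h3)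
        (natDegree_mul_le_of_le (m := 4) ?_ (natDegree_pow_le_of_le 2 h2))
      compute_degree!
    · have h1 := hql p hp
      have h2 : ((3 * p.1 + 2 * a) * p.2 ^ 2 + 4 * b * p.1 * p.2 : ℚ) =
        p.1 ^ 2 * (p.1 + 2 * a) := by exact_mod_cast (hS p hp).2
      simp only [eval_sub, eval_add, eval_mul, eval_pow, eval_neg, eval_C, eval_X]
      generalize q.eval (p.1 : ℚ) = s at *
      generalize l.eval (p.1 : ℚ) = r at *
      obtain rfl : s = -(r * p.2) := by linarith
      linear_combination r ^ 2 * (3 * p.1 + 2 * a) * h2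

/-- A residue class modulo `P` at which the curve is smooth in the `y` direction contains at most
twelve points of the curve inside a small enough box. -/
theorem card_le_twelve_of_modEq (P : ℕ) [hP : Fact P.Prime] (a b m n L : ℤ) (hL : 0 ≤ L)
    (hLP : 120 * L ^ 6 < (P : ℤ) ^ 10) (S : Finset (ℤ × ℤ))
    (hS : ∀ p ∈ S, p.1 ≠ 0 ∧
      (3 * p.1 + 2 * a) * p.2 ^ 2 + 4 * b * p.1 * p.2 = p.1 ^ 2 * (p.1 + 2 * a))
    (hbox : ∀ p ∈ S, (0 ≤ p.1 - m ∧ p.1 - m ≤ L) ∧ (0 ≤ p.2 - n ∧ p.2 - n ≤ L)) (x y : ℤ)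
    (hxy : (3 * x + 2 * a) * y ^ 2 + 4 * b * x * y = x ^ 2 * (x + 2 * a))
    (hsmooth : ¬ (P : ℤ) ∣ (3 * x + 2 * a) * (2 * y) + 4 * b * x)
    (hmod : ∀ p ∈ S, (P : ℤ) ∣ p.1 - x ∧ (P : ℤ) ∣ p.2 - y) : S.card ≤ 12 := by
  have hPp : Prime (P : ℤ) := Nat.prime_iff_prime_int.1 hP.out
  have hP0 : (P : ℤ) ≠ 0 := hPp.ne_zero
  obtain ⟨h', γ, hγ⟩ : IsCoprime ((P : ℤ) ^ 3) (-((3 * x + 2 * a) * (2 * y) + 4 * b * x)) :=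
    ((hPp.irreducible.coprime_iff_not_dvd).2 (by rwa [dvd_neg])).pow_left
  obtain ⟨f₁, f₂, f₃, hf⟩ := exists_adic_expansion P
    (-3 * y ^ 2 - 4 * b * y + 3 * x ^ 2 + 4 * a * x)
    (-((3 * x + 2 * a) * (2 * y) + 4 * b * x)) (3 * x + 2 * a) (-6 * y - 4 * b)
    (-(3 * x + 2 * a)) γ (-h') (by linear_combination hγ)
  let f : ℤ × ℤ → Fin 5 → ℤ := fun p =>
    ![1, p.1 - m, (p.1 - m) ^ 2, p.2 - n, (p.1 - m) * (p.2 - n)]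
  have hdet : ∀ p : Fin 5 → ℤ × ℤ, (∀ i, p i ∈ S) →
      Matrix.det (Matrix.of fun i => f (p i)) = 0 := by
    intro p hp
    choose u hu using fun i => (hmod _ (hp i)).1
    choose v hv using fun i => (hmod _ (hp i)).2
    have hex : ∀ i, ∃ t, v i = f₁ * u i + P * (f₂ * u i ^ 2) + P ^ 2 * (f₃ * u i ^ 3 + P * t) := by
      intro i
      refine hf _ _ (mul_left_cancel₀ hP0 ?_)
      have h1 := (hS _ (hp i)).2
      obtain ⟨h2, h3⟩ : (p i).1 = x + P * u i ∧ (p i).2 = y + P * v i :=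
        ⟨by linarith [hu i], by linarith [hv i]⟩
      rw [h2, h3] at h1
      linear_combination hxy - h1
    choose t ht using hex
    have hdvd := prime_pow_dvd_det P (x - m) (y - n) f₁ f₂ f₃ u v t ht
    have hX : ∀ i, x - m + P * u i = (p i).1 - m := fun i => by linarith [hu i]
    have hY : ∀ i, y - n + P * v i = (p i).2 - n := fun i => by linarith [hv i]
    simp only [hX, hY] at hdvd
    refine Int.eq_zero_of_abs_lt_dvd hdvd (lt_of_le_of_lt ?_ hLP)
    exact abs_det_le L hL (fun i => (p i).1 - m) (fun i => (p i).2 - n)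
      (fun i => (hbox _ (hp i)).1) (fun i => (hbox _ (hp i)).2)
  obtain ⟨c, hc, hrel⟩ := exists_common_relation (S : Set (ℤ × ℤ))
    (fun p j => ((f p j : ℤ) : ℚ)) fun p hp => by
      have := congrArg (Int.cast : ℤ → ℚ) (hdet p hp)
      rw [Int.cast_det, Int.cast_zero] at this
      exact this
  refine card_le_twelve_of_relation a b m n S hS c hc fun p hp => ?_
  have := hrel p hp
  simp [f, Fin.sum_univ_succ] at this
  linear_combination this

theorem card_image_le_two_mul (P : ℕ) [Fact P.Prime] (a b : ℤ) (S : Finset (ℤ × ℤ))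
    (hS : ∀ p ∈ S,
      (3 * p.1 + 2 * a) * p.2 ^ 2 + 4 * b * p.1 * p.2 = p.1 ^ 2 * (p.1 + 2 * a))
    (hsmooth : ∀ p ∈ S, ¬ (P : ℤ) ∣ (3 * p.1 + 2 * a) * (2 * p.2) + 4 * b * p.1) :
    (S.image fun p => ((p.1 : ZMod P), (p.2 : ZMod P))).card ≤ 2 * P := by
  refine (Finset.card_le_mul_card_image (f := Prod.fst) _ 2 fun x hx => ?_).trans
    (Nat.mul_le_mul_left 2 ((Finset.card_le_univ _).trans_eq (ZMod.card P)))
  obtain ⟨z, hz, rfl⟩ := Finset.mem_image.1 hx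
  obtain ⟨p, hp, rfl⟩ := Finset.mem_image.1 hz
  rw [← Finset.card_image_of_injOn (f := Prod.snd)]
  · refine card_le_two_of_quadratic (3 * p.1 + 2 * a : ZMod P) (4 * b * p.1)
      (-(p.1 ^ 2 * (p.1 + 2 * a))) ?_ _ fun y hy => ?_
    · rintro ⟨h1, h2, -⟩
      refine hsmooth p hp ((ZMod.intCast_zmod_eq_zero_iff_dvd _ P).1 ?_)
      push_cast
      linear_combination (2 * p.2 : ZMod P) * h1 + h2
    · obtain ⟨q, hq, rfl⟩ := Finset.mem_image.1 hy
      obtain ⟨hq, hqp⟩ := Finset.mem_filter.1 hq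
      obtain ⟨r, hr, rfl⟩ := Finset.mem_image.1 hq
      have := congrArg (Int.cast : ℤ → ZMod P) (hS r hr)
      push_cast at this
      simp only at hqp ⊢
      rw [← hqp]
      linear_combination this
  · intro q hq r hr hqr
    have h1 := (Finset.mem_filter.1 hq).2
    have h2 := (Finset.mem_filter.1 hr).2
    exact Prod.ext (h1.trans h2.symm) hqr

/-- Points at which the partial derivative in `y` vanishes modulo `P` have few abscissae. -/
theorem card_image_fst_le (P : ℕ) [hP : Fact P.Prime] (hP5 : 5 ≤ P) (a b m : ℤ) (L : ℕ)
    (S : Finset (ℤ × ℤ))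
    (hS : ∀ p ∈ S,
      (3 * p.1 + 2 * a) * p.2 ^ 2 + 4 * b * p.1 * p.2 = p.1 ^ 2 * (p.1 + 2 * a))
    (hbox : ∀ p ∈ S, 0 ≤ p.1 - m ∧ p.1 - m ≤ L)
    (hsing : ∀ p ∈ S, (P : ℤ) ∣ (3 * p.1 + 2 * a) * (2 * p.2) + 4 * b * p.1) :
    (S.image Prod.fst).card ≤ 3 * (L / P + 1) := by
  classical
  have hne : ∀ k : ℕ, 0 < k → k < 5 → (k : ZMod P) ≠ 0 := fun k hk hk5 h => by
    have := Nat.le_of_dvd hk ((ZMod.natCast_eq_zero_iff k P).1 h)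
    omega
  let Q : Finset (ZMod P) := Finset.univ.filter fun r =>
    3 * r ^ 2 + 8 * a * r + (4 * a ^ 2 + 4 * b ^ 2) = 0
  have hQ : Q.card ≤ 2 := by
    refine card_le_two_of_quadratic (3 : ZMod P) (8 * a) (4 * a ^ 2 + 4 * b ^ 2) ?_ Q
      fun y hy => (Finset.mem_filter.1 hy).2
    rintro ⟨h, -⟩
    exact hne 3 (by norm_num) (by norm_num) (by exact_mod_cast h)
  have hmem : ∀ x ∈ S.image Prod.fst,
      ((x : ZMod P), (x - m) / P) ∈ insert 0 Q ×ˢ Finset.Icc (0 : ℤ) (L / P) := by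
    intro x hx
    obtain ⟨p, hp, rfl⟩ := Finset.mem_image.1 hx
    have hP0 : (0 : ℤ) < P := by exact_mod_cast hP.out.pos
    refine Finset.mem_product.2 ⟨?_, Finset.mem_Icc.2
      ⟨Int.ediv_nonneg (hbox p hp).1 hP0.le, Int.ediv_le_ediv hP0 (hbox p hp).2⟩⟩
    have h1 := congrArg (Int.cast : ℤ → ZMod P) (hS p hp)
    have h2 := (ZMod.intCast_zmod_eq_zero_iff_dvd _ P).2 (hsing p hp)
    push_cast at h1 h2
    have h3 : (2 : ZMod P) ≠ 0 := by exact_mod_cast hne 2 (by norm_num) (by norm_num)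
    have h4 : ((3 * p.1 + 2 * a) * p.2 + 2 * b * p.1 : ZMod P) = 0 :=
      (mul_eq_zero.1 (show (2 : ZMod P) * _ = 0 by linear_combination h2)).resolve_left h3
    have h5 : (p.1 : ZMod P) ^ 2 *
        (3 * p.1 ^ 2 + 8 * a * p.1 + (4 * a ^ 2 + 4 * b ^ 2)) = 0 := by
      linear_combination ((3 * p.1 + 2 * a) * p.2 + 2 * b * p.1 : ZMod P) * h4 -
        (3 * p.1 + 2 * a : ZMod P) * h1
    rcases mul_eq_zero.1 h5 with h | h
    · exact Finset.mem_insert.2 (Or.inl (pow_eq_zero_iff two_ne_zero |>.1 h))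
    · exact Finset.mem_insert.2 (Or.inr (Finset.mem_filter.2 ⟨Finset.mem_univ _, h⟩))
  have hinj : Set.InjOn (fun x : ℤ => ((x : ZMod P), (x - m) / (P : ℤ)))
      (S.image Prod.fst : Finset ℤ) := by
    intro x _ y _ hxy
    obtain ⟨h1, h2⟩ := Prod.mk.inj hxy
    have h3 : (x - m) % P = (y - m) % P :=
      Int.ModEq.sub_right m ((ZMod.intCast_eq_intCast_iff x y P).1 h1)
    have h4 := Int.mul_ediv_add_emod (x - m) P
    have h5 := Int.mul_ediv_add_emod (y - m) P
    rw [h2, h3] at h4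
    linarith
  refine (Finset.card_le_card_of_injOn _ hmem hinj).trans ?_
  rw [Finset.card_product, Int.card_Icc]
  refine Nat.mul_le_mul ((Finset.card_insert_le _ _).trans (by omega)) ?_
  rw [sub_zero]
  exact_mod_cast (Int.toNat_natCast _).le

theorem card_le_of_box (P : ℕ) [Fact P.Prime] (hP5 : 5 ≤ P) (a b m n : ℤ) (L : ℕ)
    (hLP : 120 * (L : ℤ) ^ 6 < (P : ℤ) ^ 10) (S : Finset (ℤ × ℤ))
    (hS : ∀ p ∈ S, p.1 ≠ 0 ∧
      (3 * p.1 + 2 * a) * p.2 ^ 2 + 4 * b * p.1 * p.2 = p.1 ^ 2 * (p.1 + 2 * a))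
    (hbox : ∀ p ∈ S, (0 ≤ p.1 - m ∧ p.1 - m ≤ L) ∧ (0 ≤ p.2 - n ∧ p.2 - n ≤ L)) :
    S.card ≤ 24 * P + 6 * (L / P + 1) := by
  classical
  rw [← Finset.card_filter_add_card_filter_not
    (fun p : ℤ × ℤ => ¬ (P : ℤ) ∣ (3 * p.1 + 2 * a) * (2 * p.2) + 4 * b * p.1)]
  refine add_le_add ?_ ?_
  · set S₁ := S.filter fun p : ℤ × ℤ =>
      ¬ (P : ℤ) ∣ (3 * p.1 + 2 * a) * (2 * p.2) + 4 * b * p.1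
    have hsub : ∀ p ∈ S₁, p ∈ S := fun p hp => (Finset.mem_filter.1 hp).1
    have hsm : ∀ p ∈ S₁, ¬ (P : ℤ) ∣ (3 * p.1 + 2 * a) * (2 * p.2) + 4 * b * p.1 :=
      fun p hp => (Finset.mem_filter.1 hp).2
    have h1 := card_image_le_two_mul P a b S₁ (fun p hp => (hS p (hsub p hp)).2) hsm
    have h2 := Finset.card_le_mul_card_image
      (f := fun p : ℤ × ℤ => ((p.1 : ZMod P), (p.2 : ZMod P))) S₁ 12 fun z hz => ?_
    · omega
    · obtain ⟨p, hp, rfl⟩ := Finset.mem_image.1 hz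
      refine card_le_twelve_of_modEq P a b m n L (by positivity) hLP _
        (fun q hq => hS q (hsub q (Finset.mem_filter.1 hq).1))
        (fun q hq => hbox q (hsub q (Finset.mem_filter.1 hq).1)) p.1 p.2
        (hS p (hsub p hp)).2 (hsm p hp) fun q hq => ?_
      obtain ⟨hq1, hq2⟩ := Prod.mk.inj (Finset.mem_filter.1 hq).2
      constructor <;> rw [← ZMod.intCast_zmod_eq_zero_iff_dvd] <;> push_cast <;>
        rw [sub_eq_zero] <;> assumption
  · set S₂ := S.filter fun p : ℤ × ℤ =>
      ¬ ¬ (P : ℤ) ∣ (3 * p.1 + 2 * a) * (2 * p.2) + 4 * b * p.1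
    have hsub : ∀ p ∈ S₂, p ∈ S := fun p hp => (Finset.mem_filter.1 hp).1
    have h1 := card_image_fst_le P hP5 a b m L S₂ (fun p hp => (hS p (hsub p hp)).2)
      (fun p hp => (hbox p (hsub p hp)).1) fun p hp => not_not.1 (Finset.mem_filter.1 hp).2
    have h2 := card_le_two_mul_card_image_fst a b S₂ fun p hp => hS p (hsub p hp)
    omega

/-- For fixed `(ξ₁,η₁) ∈ ℤ²`, the number of lattice points `(ξ,η)` in any axis-parallel
square of side length `2R`, not satisfying `ξ = ξ₁ = 0`, lying on the cubic
hyperbola-like curve `(x + 2ξ₁)(x² − y²) = 2(y + 2η₁)xy` with `x = ξ − 2ξ₁`,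
`y = η − 2η₁`, is at most `c(ε)·R^(3/5+ε)`. -/
theorem lattice_count_cubic_curve :
    ∀ ε > (0 : ℝ), ∃ c > (0 : ℝ), ∀ ξ₁ η₁ : ℤ, ∀ R : ℝ, 1 ≤ R → ∀ a₀ b₀ : ℝ,
      (Set.ncard {q : ℤ × ℤ |
          (a₀ ≤ (q.1 : ℝ) ∧ (q.1 : ℝ) ≤ a₀ + 2 * R) ∧
          (b₀ ≤ (q.2 : ℝ) ∧ (q.2 : ℝ) ≤ b₀ + 2 * R) ∧
          ¬(q.1 = 0 ∧ ξ₁ = 0) ∧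
          ((q.1 - 2 * ξ₁) + 2 * ξ₁) * ((q.1 - 2 * ξ₁) ^ 2 - (q.2 - 2 * η₁) ^ 2) =
            2 * ((q.2 - 2 * η₁) + 2 * η₁) * (q.1 - 2 * ξ₁) * (q.2 - 2 * η₁)} : ℝ)
        ≤ c * R ^ ((3 : ℝ) / 5 + ε) := by
  intro ε hε
  refine ⟨205, by norm_num, fun ξ₁ η₁ R hR a₀ b₀ => ?_⟩
  have hR0 : 0 ≤ R := by linarith
  obtain ⟨r, hr⟩ : ∃ r, r = R ^ ((3 : ℝ) / 5) := ⟨_, rfl⟩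
  have hr1 : 1 ≤ r := hr ▸ Real.one_le_rpow hR (by norm_num)
  have hr10 : r ^ 10 = R ^ 6 := by
    rw [hr, ← Real.rpow_natCast, ← Real.rpow_mul hR0, ← Real.rpow_natCast]
    norm_num
  have hr2 : R ≤ r ^ 2 := by
    rw [hr, ← Real.rpow_natCast, ← Real.rpow_mul hR0]
    exact Real.self_le_rpow_of_one_le hR (by norm_num)
  have hrε : r ≤ R ^ ((3 : ℝ) / 5 + ε) :=
    hr ▸ Real.rpow_le_rpow_of_exponent_le hR (by linarith)
  have hN : ⌈3 * r⌉₊ ≠ 0 := (Nat.ceil_pos.2 (by linarith)).ne'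
  obtain ⟨P, hP, hNP, hPN⟩ := Nat.exists_prime_lt_and_le_two_mul _ hN
  have : Fact P.Prime := ⟨hP⟩
  have hrP : 3 * r < P := (Nat.le_ceil _).trans_lt (by exact_mod_cast hNP)
  have hPr : (P : ℝ) ≤ 8 * r := by
    have h1 : (P : ℝ) ≤ 2 * ⌈3 * r⌉₊ := by exact_mod_cast hPN
    have h2 := Nat.ceil_lt_add_one (show 0 ≤ 3 * r by linarith)
    linarith
  have hP5 : 5 ≤ P := by
    have h3 : 3 < P := by
      have : (3 : ℝ) < P := by linarith
      exact_mod_cast this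
    rcases Nat.lt_or_ge 4 P with h | h
    · exact h
    · obtain rfl : P = 4 := by omega
      norm_num at hP
  obtain ⟨L, hL⟩ : ∃ L, L = ⌊2 * R⌋₊ := ⟨_, rfl⟩
  have hL2 : (L : ℝ) ≤ 2 * R := hL ▸ Nat.floor_le (by linarith)
  have hLP : 120 * (L : ℤ) ^ 6 < (P : ℤ) ^ 10 := by
    have h1 : (L : ℝ) ^ 6 ≤ (2 * R) ^ 6 := pow_le_pow_left₀ (by positivity) hL2 6
    have h2 : (3 * r) ^ 10 < (P : ℝ) ^ 10 := pow_lt_pow_left₀ hrP (by linarith) (by norm_num)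
    have h3 : 0 ≤ R ^ 6 := by positivity
    have : 120 * (L : ℝ) ^ 6 < (P : ℝ) ^ 10 := by
      rw [mul_pow] at h1 h2
      rw [hr10] at h2
      linarith
    exact_mod_cast this
  have hLdiv : ((L / P : ℕ) : ℝ) ≤ r := by
    refine Nat.cast_div_le.trans ((div_le_iff₀ (by linarith)).2 ?_)
    nlinarith
  have hfloor : ∀ (c : ℝ) (z : ℤ), c ≤ z → (z : ℝ) ≤ c + 2 * R →
      0 ≤ z - ⌈c⌉ ∧ z - ⌈c⌉ ≤ (L : ℤ) := by
    intro c z h1 h2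
    refine ⟨sub_nonneg.2 (Int.ceil_le.2 h1), ?_⟩
    rw [hL, Int.natCast_floor_eq_floor (by linarith)]
    refine Int.le_floor.2 ?_
    push_cast
    linarith [Int.le_ceil c]
  let m := ⌈a₀⌉ - 2 * ξ₁
  let n := ⌈b₀⌉ - 2 * η₁
  let T : Finset (ℤ × ℤ) := (Finset.Icc m (m + L) ×ˢ Finset.Icc n (n + L)).filter fun p =>
    p.1 ≠ 0 ∧
      (3 * p.1 + 2 * ξ₁) * p.2 ^ 2 + 4 * η₁ * p.1 * p.2 = p.1 ^ 2 * (p.1 + 2 * ξ₁)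
  have hT : T.card ≤ 24 * P + 6 * (L / P + 1) := by
    refine card_le_of_box P hP5 ξ₁ η₁ m n L hLP T (fun p hp => (Finset.mem_filter.1 hp).2)
      fun p hp => ?_
    have := (Finset.mem_filter.1 hp).1
    rw [Finset.mem_product, Finset.mem_Icc, Finset.mem_Icc] at this
    omega
  have hcard : (Set.ncard {q : ℤ × ℤ |
          (a₀ ≤ (q.1 : ℝ) ∧ (q.1 : ℝ) ≤ a₀ + 2 * R) ∧
          (b₀ ≤ (q.2 : ℝ) ∧ (q.2 : ℝ) ≤ b₀ + 2 * R) ∧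
          ¬(q.1 = 0 ∧ ξ₁ = 0) ∧
          ((q.1 - 2 * ξ₁) + 2 * ξ₁) * ((q.1 - 2 * ξ₁) ^ 2 - (q.2 - 2 * η₁) ^ 2) =
            2 * ((q.2 - 2 * η₁) + 2 * η₁) * (q.1 - 2 * ξ₁) * (q.2 - 2 * η₁)}) ≤
      24 * P + 6 * (L / P + 1) + 1 := by
    refine le_trans ?_ ((Finset.card_image_le
      (f := fun p : ℤ × ℤ => (p.1 + 2 * ξ₁, p.2 + 2 * η₁))).trans
        ((Finset.card_insert_le (0, 0) T).trans (Nat.add_le_add_right hT 1)))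
    rw [← Set.ncard_coe_finset]
    refine Set.ncard_le_ncard ?_ (Finset.finite_toSet _)
    rintro ⟨ξ, η⟩ ⟨⟨h1, h2⟩, ⟨h3, h4⟩, h5, h6⟩
    refine Finset.mem_coe.2 (Finset.mem_image.2 ⟨(ξ - 2 * ξ₁, η - 2 * η₁), ?_, by simp⟩)
    simp only at h1 h2 h3 h4 h5 h6
    rw [Finset.mem_insert]
    by_cases h0 : ξ - 2 * ξ₁ = 0
    · left
      rw [h0] at h6
      have h7 : 2 * ξ₁ * (η - 2 * η₁) ^ 2 = 0 := by linear_combination -h6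
      have h8 : ξ₁ ≠ 0 := fun h => h5 ⟨by omega, h⟩
      have h9 : η - 2 * η₁ = 0 := by simpa [h8] using h7
      rw [h0, h9]
    · right
      have hb1 := hfloor a₀ ξ h1 h2
      have hb2 := hfloor b₀ η h3 h4
      refine Finset.mem_filter.2 ⟨?_, h0, ?_⟩
      · rw [Finset.mem_product, Finset.mem_Icc, Finset.mem_Icc]
        simp only [m, n]
        omega
      · linear_combination -h6
  have hcard' : _ ≤ ((24 * P + 6 * (L / P + 1) + 1 : ℕ) : ℝ) := Nat.cast_le.2 hcard
  refine hcard'.trans ?_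
  push_cast at hLdiv ⊢
  linarith
end

section
/- For every ε > 0 there exists a constant C(ε) > 0 such that for all R ≥ 1, every point p ∈ ℝ², and all finitely supported functions a, b : ℤ² → ℂ where a is supported in the closed disk {q ∈ ℝ² : |q − p| ≤ R}, one has ∑_{(ξ,η,τ) ∈ ℤ³} | ∑ a(ξ₁,η₁)·b(ξ−ξ₁, η−η₁) |² ≤ C(ε)·R^{3/5 + ε} · (∑_{(ξ₁,η₁) ∈ ℤ²} |a(ξ₁,η₁)|²) · (∑_{(ξ₂,η₂) ∈ ℤ²} |b(ξ₂,η₂)|²), where the inner sum runs over those (ξ₁,η₁) ∈ ℤ² satisfying τ = φ(ξ₁,η₁) + φ(ξ−ξ₁, η−η₁) and not satisfying ξ = 0 and ξ₁ = 0 simultaneously, and φ(ξ,η) = ξ³ − 3ξη². -/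
/-- The phase function of the linearized Novikov-Veselov equation, on `ℤ²`. -/
def phiZ (ξ η : ℤ) : ℤ := ξ ^ 3 - 3 * ξ * η ^ 2

/-- Rotating a nonzero vector into asymptotic coordinates of the quadratic form
`Re (w * (x + i y) ^ 2)`, where `w = ξ + i η`. -/
theorem exists_asymptotic_coordinates {ξ η : ℝ} (h : ¬(ξ = 0 ∧ η = 0)) :
    ∃ p q ρ : ℝ, ρ ≠ 0 ∧ p ^ 2 + q ^ 2 = 1 ∧
      ∀ x y : ℝ, (p * x - q * y) * (q * x + p * y)
        = ρ * (ξ * (x ^ 2 - y ^ 2) - 2 * η * (x * y)) := by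
  set w : ℂ := ⟨-η, ξ⟩ with hw
  have hw0 : w ≠ 0 := fun h0 => h ⟨by simpa [hw] using congrArg Complex.im h0,
    by simpa [hw] using congrArg Complex.re h0⟩
  have hn : 0 < ‖w‖ := norm_pos_iff.2 hw0
  obtain ⟨z, hz⟩ := IsAlgClosed.exists_pow_nat_eq (w / (‖w‖ : ℂ)) (n := 2) (by norm_num)
  have hz1 : ‖z‖ ^ 2 = 1 := by
    rw [← norm_pow, hz, norm_div, Complex.norm_real, norm_norm, div_self hn.ne']
  have hre := congrArg Complex.re hz
  have him := congrArg Complex.im hz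
  rw [Complex.div_ofReal_re] at hre
  rw [Complex.div_ofReal_im] at him
  simp only [sq, Complex.mul_re, Complex.mul_im] at hre him
  refine ⟨z.re, z.im, 1 / (2 * ‖w‖), by positivity, ?_, fun x y => ?_⟩
  · rw [← hz1, Complex.sq_norm, Complex.normSq_apply]; ring
  · have h1 : z.re * z.im = ξ / ‖w‖ / 2 := by simp only [hw] at him ⊢; linarith
    have h2 : z.re * z.re - z.im * z.im = -η / ‖w‖ := hre
    calc _ = (z.re * z.im) * (x ^ 2 - y ^ 2) + (z.re * z.re - z.im * z.im) * (x * y) := by ring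
      _ = _ := by rw [h1, h2]; field_simp; ring

open Matrix in
/-- The determinant of the monomials `1, s, t, s², t²` at five points of the hyperbola `s t = κ`. -/
theorem abs_det_hyperbola {κ : ℝ} (s t : Fin 5 → ℝ) (h : ∀ i, s i * t i = κ) :
    (∏ i, s i ^ 2) * |(Matrix.of fun i => ![1, s i, t i, s i ^ 2, t i ^ 2]).det|
      = |κ| ^ 3 * ∏ i, ∏ j ∈ Finset.Ioi i, |s j - s i| := by
  let σ : Equiv.Perm (Fin 5) :=
    ⟨![2, 3, 1, 4, 0], ![4, 2, 0, 1, 3], by decide, by decide⟩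
  have hM : (Matrix.of fun i j => s i ^ 2 * (Matrix.of fun i =>
      ![1, s i, t i, s i ^ 2, t i ^ 2]) i j)
      = Matrix.of fun i j => ![1, 1, κ, 1, κ ^ 2] j *
        ((vandermonde s).submatrix id σ) i j := by
    ext i j
    have := h i
    fin_cases j <;> simp [σ, vandermonde_apply, ← this] <;> ring
  have hd := congrArg (fun M => |M.det|) hM
  simp only [det_mul_column, det_mul_row, det_permute', det_vandermonde, abs_mul,
    Finset.abs_prod] at hd
  have hsgn : |(((Equiv.Perm.sign σ : ℤˣ) : ℤ) : ℝ)| = 1 := by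
    rcases Int.units_eq_one_or (Equiv.Perm.sign σ) with h | h <;> rw [h] <;> simp
  rw [hsgn, one_mul] at hd
  simp only [Fin.prod_univ_five, abs_pow, sq_abs] at hd ⊢
  simp at hd
  rw [hd]
  congr 1
  rw [← sq_abs κ]
  ring

/-- Five distinct lattice points on a rotated rectangular hyperbola `s t = κ` have a monomial
determinant bounded below. -/
theorem one_le_det_hyperbola {p q κ : ℝ} (hpq : p ^ 2 + q ^ 2 = 1)
    (x y : Fin 5 → ℤ) (s t : Fin 5 → ℝ) (hs : ∀ i, s i = p * x i - q * y i)
    (ht : ∀ i, t i = q * x i + p * y i) (h : ∀ i, s i * t i = κ)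
    (hD : (Matrix.of fun i => ![1, s i, t i, s i ^ 2, t i ^ 2]).det ≠ 0) :
    1 ≤ 4 * (Matrix.of fun i => ![1, s i, t i, s i ^ 2, t i ^ 2]).det ^ 2 := by
  set E : Matrix (Fin 5) (Fin 5) ℝ := Matrix.of fun i => ![1, s i, t i, s i ^ 2, t i ^ 2]
  let G : Matrix (Fin 5) (Fin 5) ℤ :=
    Matrix.of fun i => ![1, x i, y i, x i ^ 2 + y i ^ 2, x i ^ 2 - y i ^ 2]
  let H : Matrix (Fin 5) (Fin 5) ℤ :=
    Matrix.of fun i => ![1, x i, y i, x i ^ 2 + y i ^ 2, 2 * (x i * y i)]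
  let B (c d : ℝ) : Matrix (Fin 5) (Fin 5) ℝ :=
    !![1, 0, 0, 0, d; 0, p, -q, 0, 0; 0, q, p, 0, 0; 0, 0, 0, 1, c; 0, 0, 0, 1, -c]
  have hB (c d : ℝ) : (B c d).det = -2 * c := by
    have : (B c d).det = -2 * c * (p ^ 2 + q ^ 2) := by
      simp [B, Matrix.det_succ_row_zero, Fin.sum_univ_succ, Fin.succAbove]
      ring
    rw [this, hpq, mul_one]
  have hx (i) : (x i : ℝ) = p * s i + q * t i := by
    rw [hs, ht]; linear_combination (-(x i : ℝ)) * hpq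
  have hy (i) : (y i : ℝ) = -q * s i + p * t i := by
    rw [hs, ht]; linear_combination (-(y i : ℝ)) * hpq
  have hG : G.map (Int.castRingHom ℝ) = E * B (p ^ 2 - q ^ 2) (4 * p * q * κ) := by
    ext i j
    have := h i
    fin_cases j <;> simp [G, E, B, Matrix.mul_apply, Fin.sum_univ_succ, hx, hy]
    · ring
    · ring
    · linear_combination (s i ^ 2 + t i ^ 2) * hpq
    · linear_combination (4 * p * q) * this
  have hH : H.map (Int.castRingHom ℝ) = E * B (-(2 * p * q)) (2 * (p ^ 2 - q ^ 2) * κ) := by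
    ext i j
    have := h i
    fin_cases j <;> simp [H, E, B, Matrix.mul_apply, Fin.sum_univ_succ, hx, hy]
    · ring
    · ring
    · linear_combination (s i ^ 2 + t i ^ 2) * hpq
    · linear_combination (2 * (p ^ 2 - q ^ 2)) * this
  have hGd : (G.det : ℝ) = E.det * (-2 * (p ^ 2 - q ^ 2)) := by
    rw [← hB, ← Matrix.det_mul, ← hG]; exact RingHom.map_det (Int.castRingHom ℝ) G
  have hHd : (H.det : ℝ) = E.det * (-2 * (-(2 * p * q))) := by
    rw [← hB _ (2 * (p ^ 2 - q ^ 2) * κ), ← Matrix.det_mul, ← hH]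
    exact RingHom.map_det (Int.castRingHom ℝ) H
  have hsum : ((G.det ^ 2 + H.det ^ 2 : ℤ) : ℝ) = 4 * E.det ^ 2 := by
    rw [Int.cast_add, Int.cast_pow, Int.cast_pow, hGd, hHd]
    linear_combination 4 * E.det ^ 2 * (p ^ 2 + q ^ 2 + 1) * hpq
  rw [← hsum]
  have : (0 : ℝ) < ((G.det ^ 2 + H.det ^ 2 : ℤ) : ℝ) := by rw [hsum]; positivity
  exact_mod_cast Int.cast_pos.1 this

theorem add_one_le_four_rpow {a b : ℝ} (ha : 1 ≤ a) (hab : a + a ^ (2 / 5 : ℝ) / 2 ≤ b) :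
    4 * a ^ (3 / 5 : ℝ) + 1 ≤ 4 * b ^ (3 / 5 : ℝ) := by
  have ha0 : 0 ≤ a := by linarith
  set r := a ^ (1 / 5 : ℝ) with hr
  have hr1 : 1 ≤ r := Real.one_le_rpow ha (by norm_num)
  have h5 : r ^ 5 = a := by
    rw [hr, ← Real.rpow_natCast, ← Real.rpow_mul ha0]; norm_num
  have h2 : a ^ (2 / 5 : ℝ) = r ^ 2 := by
    rw [hr, ← Real.rpow_natCast, ← Real.rpow_mul ha0]; norm_num
  have h3 : a ^ (3 / 5 : ℝ) = r ^ 3 := by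
    rw [hr, ← Real.rpow_natCast, ← Real.rpow_mul ha0]; norm_num
  rw [h2, ← h5] at hab
  rw [h3]
  have hb0 : 0 ≤ b := le_trans (by positivity) hab
  have hpoly : (r ^ 3 + 1 / 4) ^ 5 ≤ (r ^ 5 + r ^ 2 / 2) ^ 3 := by
    have hc : 1 ≤ r ^ 3 := one_le_pow₀ hr1
    have : (r ^ 5 + r ^ 2 / 2) ^ 3 = (r ^ 3) ^ 2 * (r ^ 3 + 1 / 2) ^ 3 := by ring
    rw [this]
    generalize r ^ 3 = c at hc
    obtain ⟨e, rfl⟩ : ∃ e, c = 1 + e := ⟨c - 1, by ring⟩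
    have he : 0 ≤ e := by linarith
    rw [← sub_nonneg]
    ring_nf
    positivity
  have hpow : (r ^ 3 + 1 / 4) ^ 5 ≤ (b ^ (3 / 5 : ℝ)) ^ 5 := by
    calc _ ≤ (r ^ 5 + r ^ 2 / 2) ^ 3 := hpoly
      _ ≤ b ^ 3 := by gcongr
      _ = _ := by
        rw [← Real.rpow_natCast (b ^ _), ← Real.rpow_mul hb0, ← Real.rpow_natCast b]; norm_num
  have := le_of_pow_le_pow_left₀ (by norm_num) (by positivity) hpow
  linarith

/-- A short piece of a rotated rectangular hyperbola holds at most four lattice points. -/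
theorem card_le_four_of_close {p q κ : ℝ} (hpq : p ^ 2 + q ^ 2 = 1) (hκ : κ ≠ 0)
    (T : Finset (ℤ × ℤ)) (s t : ℤ × ℤ → ℝ) (hs : ∀ z, s z = p * z.1 - q * z.2)
    (ht : ∀ z, t z = q * z.1 + p * z.2) (h : ∀ z ∈ T, s z * t z = κ)
    (h1 : ∀ z ∈ T, 1 ≤ s z) (hle : ∀ z ∈ T, |κ| ≤ s z ^ 2)
    (hclose : ∀ z ∈ T, ∀ z' ∈ T, s z' < s z + s z ^ (2 / 5 : ℝ) / 2) : T.card ≤ 4 := by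
  by_contra! hcard
  obtain ⟨U, hUT, hU⟩ := Finset.exists_subset_card_eq hcard
  let g : Fin 5 → ℤ × ℤ := fun i => ((Finset.equivFinOfCardEq hU).symm i : ℤ × ℤ)
  have hg : Function.Injective g :=
    Subtype.val_injective.comp (Finset.equivFinOfCardEq hU).symm.injective
  have hgT (i) : g i ∈ T := hUT ((Finset.equivFinOfCardEq hU).symm i).2
  obtain ⟨k, hk⟩ := Finite.exists_min fun i => s (g i)
  set m := s (g k) with hm
  have hm1 : 1 ≤ m := h1 _ (hgT k)
  have hm0 : 0 < m := by linarith
  set d := m ^ (2 / 5 : ℝ) / 2 with hd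
  have hd0 : 0 ≤ d := by positivity
  have hd10 : d ^ 10 = m ^ 4 / 1024 := by
    rw [hd, div_pow, ← Real.rpow_natCast (m ^ _), ← Real.rpow_mul hm0.le, ← Real.rpow_natCast m]
    norm_num
  have hdist (i j) : |s (g j) - s (g i)| ≤ d := by
    have := hclose _ (hgT k) _ (hgT i)
    have := hclose _ (hgT k) _ (hgT j)
    have := hk i
    have := hk j
    rw [abs_le]
    constructor <;> linarith
  have hform := abs_det_hyperbola (fun i => s (g i)) (fun i => t (g i)) (fun i => h _ (hgT i))
  have hlow := one_le_det_hyperbola hpq (fun i => (g i).1) (fun i => (g i).2)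
    (fun i => s (g i)) (fun i => t (g i)) (fun i => hs _) (fun i => ht _) (fun i => h _ (hgT i))
  set D := (Matrix.of fun i => ![1, s (g i), t (g i), s (g i) ^ 2, t (g i) ^ 2]).det
  have hinj : Function.Injective fun i => s (g i) := by
    intro i j hij
    have hij : s (g i) = s (g j) := hij
    have hs0 : s (g j) ≠ 0 := by have := h1 _ (hgT j); positivity
    have htt : t (g i) = t (g j) := mul_left_cancel₀ hs0 <| by
      rw [h _ (hgT j), ← hij, h _ (hgT i)]
    rw [hs, hs] at hij
    rw [ht, ht] at htt
    apply hg
    have e1 : ((g i).1 : ℝ) = (g j).1 := by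
      linear_combination p * hij + q * htt - (((g i).1 : ℝ) - (g j).1) * hpq
    have e2 : ((g i).2 : ℝ) = (g j).2 := by
      linear_combination -q * hij + p * htt - (((g i).2 : ℝ) - (g j).2) * hpq
    exact Prod.ext (by exact_mod_cast e1) (by exact_mod_cast e2)
  have hD0 : D ≠ 0 := by
    intro hD
    rw [hD, abs_zero, mul_zero, eq_comm, mul_eq_zero] at hform
    rcases hform with hf | hf
    · exact hκ (by simpa using hf)
    · simp only [Finset.prod_eq_zero_iff, abs_eq_zero, sub_eq_zero] at hf
      obtain ⟨i, -, j, hj, hf⟩ := hf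
      exact (Finset.mem_Ioi.1 hj).ne' (hinj hf)
  have hprod : ∏ i : Fin 5, ∏ j ∈ Finset.Ioi i, |s (g j) - s (g i)| ≤ d ^ 10 :=
    calc _ ≤ ∏ i : Fin 5, ∏ j ∈ Finset.Ioi i, d :=
          Finset.prod_le_prod (fun i _ => Finset.prod_nonneg fun j _ => abs_nonneg _)
            fun i _ => Finset.prod_le_prod (fun j _ => abs_nonneg _) fun j _ => hdist i j
      _ = d ^ 10 := by
        simp only [Finset.prod_const, Fin.card_Ioi, Fin.prod_univ_five]
        simp
        ring
  have hden : m ^ 10 ≤ ∏ i : Fin 5, s (g i) ^ 2 :=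
    calc m ^ 10 = ∏ _i : Fin 5, m ^ 2 := by simp; ring
      _ ≤ _ := Finset.prod_le_prod (fun i _ => by positivity) fun i _ => by
        have := hk i
        gcongr
  have hκm : |κ| ≤ m ^ 2 := hle _ (hgT k)
  have hup : m ^ 10 * |D| ≤ m ^ 10 * (1 / 1024) :=
    calc m ^ 10 * |D| ≤ (∏ i : Fin 5, s (g i) ^ 2) * |D| := by gcongr
      _ = |κ| ^ 3 * ∏ i : Fin 5, ∏ j ∈ Finset.Ioi i, |s (g j) - s (g i)| := hform
      _ ≤ (m ^ 2) ^ 3 * d ^ 10 := by gcongr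
      _ = m ^ 10 * (1 / 1024) := by rw [hd10]; ring
  have hDle : |D| ≤ 1 / 1024 := le_of_mul_le_mul_left hup (by positivity)
  have := hlow hD0
  rw [← sq_abs] at this
  nlinarith [abs_nonneg D]

/-- Lattice points on the part of a rotated rectangular hyperbola that lies in the cone
`|t| ≤ s`, away from the origin. -/
theorem card_hyperbola_cone_le {p q κ L : ℝ} (hpq : p ^ 2 + q ^ 2 = 1) (hκ : κ ≠ 0)
    (hL : 0 ≤ L) (T : Finset (ℤ × ℤ)) (s t : ℤ × ℤ → ℝ) (hs : ∀ z, s z = p * z.1 - q * z.2)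
    (ht : ∀ z, t z = q * z.1 + p * z.2) (h : ∀ z ∈ T, s z * t z = κ)
    (h1 : ∀ z ∈ T, 1 ≤ s z) (hle : ∀ z ∈ T, |t z| ≤ s z)
    (hdiam : ∀ z ∈ T, ∀ z' ∈ T, s z' - s z ≤ L) :
    (T.card : ℝ) ≤ 4 * (4 * L ^ (3 / 5 : ℝ) + 2) := by
  rcases T.eq_empty_or_nonempty with rfl | hT
  · simp; positivity
  obtain ⟨k, hkT, hk⟩ := T.exists_min_image s hT
  set f : ℤ × ℤ → ℤ := fun z => ⌊4 * s z ^ (3 / 5 : ℝ)⌋ with hf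
  have hfib (n : ℤ) (_ : n ∈ T.image f) : (T.filter fun z => f z = n).card ≤ 4 := by
    refine card_le_four_of_close hpq hκ _ s t hs ht
      (fun z hz => h z (Finset.mem_filter.1 hz).1) (fun z hz => h1 z (Finset.mem_filter.1 hz).1)
      (fun z hz => ?_) fun z hz z' hz' => ?_
    · have hz := (Finset.mem_filter.1 hz).1
      have := h1 z hz
      rw [← h z hz, abs_mul, abs_of_nonneg (by linarith : 0 ≤ s z), sq]
      exact mul_le_mul_of_nonneg_left (hle z hz) (by linarith)
    · obtain ⟨hz, hzn⟩ := Finset.mem_filter.1 hz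
      obtain ⟨hz', hzn'⟩ := Finset.mem_filter.1 hz'
      by_contra! hcon
      have := add_one_le_four_rpow (h1 z hz) hcon
      have h2 := Int.floor_le (4 * s z ^ (3 / 5 : ℝ))
      have h3 := Int.lt_floor_add_one (4 * s z' ^ (3 / 5 : ℝ))
      have h4 : ⌊4 * s z ^ (3 / 5 : ℝ)⌋ = ⌊4 * s z' ^ (3 / 5 : ℝ)⌋ := hzn.trans hzn'.symm
      have h5 : ⌊4 * s z ^ (3 / 5 : ℝ) + 1⌋ ≤ ⌊4 * s z' ^ (3 / 5 : ℝ)⌋ := Int.floor_le_floor this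
      rw [Int.floor_add_one] at h5
      omega
  have hcard : T.card ≤ 4 * (T.image f).card := Finset.card_le_mul_card_image T 4 hfib
  set α := 4 * s k ^ (3 / 5 : ℝ) with hα
  set β := 4 * L ^ (3 / 5 : ℝ) with hβ
  have hβ0 : 0 ≤ β := by positivity
  have himg : T.image f ⊆ Finset.Icc ⌊α⌋ ⌊α + β⌋ := by
    intro n hn
    obtain ⟨z, hz, rfl⟩ := Finset.mem_image.1 hn
    have hk0 : 0 ≤ s k := by linarith [h1 k hkT]
    have hz0 : 0 ≤ s z := by linarith [h1 z hz]
    refine Finset.mem_Icc.2 ⟨Int.floor_le_floor ?_, Int.floor_le_floor ?_⟩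
    · have := hk z hz
      rw [hα]; gcongr
    · have h2 : s z ^ (3 / 5 : ℝ) ≤ (s k + L) ^ (3 / 5 : ℝ) := by
        have := hdiam k hkT z hz
        gcongr
        linarith
      have h3 : (s k + L) ^ (3 / 5 : ℝ) ≤ s k ^ (3 / 5 : ℝ) + L ^ (3 / 5 : ℝ) := by
        exact_mod_cast NNReal.rpow_add_le_add_rpow ⟨s k, hk0⟩ ⟨L, hL⟩
          (by norm_num : (0 : ℝ) ≤ 3 / 5) (by norm_num)
      rw [hα, hβ]; linarith
  have hicc : ((Finset.Icc ⌊α⌋ ⌊α + β⌋).card : ℝ) ≤ β + 2 := by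
    rw [Int.card_Icc]
    have h0 : ⌊α⌋ ≤ ⌊α + β⌋ := Int.floor_le_floor (by linarith)
    have h1 : (((⌊α + β⌋ + 1 - ⌊α⌋).toNat : ℤ) : ℝ) = ((⌊α + β⌋ + 1 - ⌊α⌋ : ℤ) : ℝ) := by
      rw [Int.toNat_of_nonneg (by omega)]
    have h2 := Int.floor_le (α + β)
    have h3 := Int.lt_floor_add_one α
    rw [← Int.cast_natCast, h1]
    push_cast
    linarith
  have h6 : ((T.image f).card : ℝ) ≤ (Finset.Icc ⌊α⌋ ⌊α + β⌋).card := by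
    exact_mod_cast Finset.card_le_card himg
  have h7 : (T.card : ℝ) ≤ 4 * (T.image f).card := by exact_mod_cast hcard
  linarith

/-- A rotated rectangular hyperbola has `O(L ^ (3 / 5))` lattice points in a set of diameter
`L`, uniformly in the hyperbola. -/
theorem card_hyperbola_le {p q κ L : ℝ} (hpq : p ^ 2 + q ^ 2 = 1) (hκ : κ ≠ 0)
    (hL : 0 ≤ L) (T : Finset (ℤ × ℤ))
    (h : ∀ z ∈ T, (p * z.1 - q * z.2) * (q * z.1 + p * z.2) = κ)
    (hdiam : ∀ z ∈ T, ∀ z' ∈ T,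
      ((z'.1 : ℝ) - z.1) ^ 2 + ((z'.2 : ℝ) - z.2) ^ 2 ≤ L ^ 2) :
    (T.card : ℝ) ≤ 64 * L ^ (3 / 5 : ℝ) + 41 := by
  classical
  let s : ℤ × ℤ → ℝ := fun z => p * z.1 - q * z.2
  let t : ℤ × ℤ → ℝ := fun z => q * z.1 + p * z.2
  have key (p q κ : ℝ) (hpq : p ^ 2 + q ^ 2 = 1) (hκ : κ ≠ 0)
      (h : ∀ z ∈ T, (p * z.1 - q * z.2) * (q * z.1 + p * z.2) = κ) :
      ((T.filter fun z => 1 ≤ p * z.1 - q * z.2 ∧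
        |q * z.1 + p * z.2| ≤ p * z.1 - q * z.2).card : ℝ) ≤ 4 * (4 * L ^ (3 / 5 : ℝ) + 2) := by
    refine card_hyperbola_cone_le hpq hκ hL _ (fun z => p * z.1 - q * z.2)
      (fun z => q * z.1 + p * z.2) (fun z => rfl) (fun z => rfl)
      (fun z hz => h z (Finset.mem_filter.1 hz).1) (fun z hz => (Finset.mem_filter.1 hz).2.1)
      (fun z hz => (Finset.mem_filter.1 hz).2.2) fun z hz z' hz' => ?_
    have hd := hdiam z (Finset.mem_filter.1 hz).1 z' (Finset.mem_filter.1 hz').1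
    refine abs_le_of_sq_le_sq' ?_ hL |>.2
    calc _ ≤ (p * (z'.1 - z.1) - q * (z'.2 - z.2)) ^ 2
            + (q * (z'.1 - z.1) + p * (z'.2 - z.2)) ^ 2 := by
          have := sq_nonneg (q * ((z'.1 : ℝ) - z.1) + p * (z'.2 - z.2))
          linarith
      _ = (p ^ 2 + q ^ 2) * (((z'.1 : ℝ) - z.1) ^ 2 + ((z'.2 : ℝ) - z.2) ^ 2) := by ring
      _ ≤ L ^ 2 := by rw [hpq, one_mul]; exact hd
  have k1 := key p q κ hpq hκ h
  have k2 := key (-p) (-q) κ (by linarith) hκ fun z hz => by linarith [h z hz]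
  have k3 := key q (-p) (-κ) (by linarith) (neg_ne_zero.2 hκ) fun z hz => by linarith [h z hz]
  have k4 := key (-q) p (-κ) (by linarith) (neg_ne_zero.2 hκ) fun z hz => by linarith [h z hz]
  have k0 : (((Finset.Icc (-1) 1 ×ˢ Finset.Icc (-1) 1 : Finset (ℤ × ℤ))).card : ℝ) = 9 := by
    exact_mod_cast (by decide : (Finset.Icc (-1) 1 ×ˢ Finset.Icc (-1) 1 : Finset (ℤ × ℤ)).card = 9)
  have hsub : T ⊆ (Finset.Icc (-1) 1 ×ˢ Finset.Icc (-1) 1) ∪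
      ((T.filter fun z => 1 ≤ p * z.1 - q * z.2 ∧ |q * z.1 + p * z.2| ≤ p * z.1 - q * z.2) ∪
      ((T.filter fun z => 1 ≤ -p * z.1 - -q * z.2 ∧
        |-q * z.1 + -p * z.2| ≤ -p * z.1 - -q * z.2) ∪
      ((T.filter fun z => 1 ≤ q * z.1 - -p * z.2 ∧
        |-p * z.1 + q * z.2| ≤ q * z.1 - -p * z.2) ∪
      (T.filter fun z => 1 ≤ -q * z.1 - p * z.2 ∧
        |p * z.1 + -q * z.2| ≤ -q * z.1 - p * z.2)))) := by
    intro z hz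
    simp only [Finset.mem_union, Finset.mem_filter, hz, true_and]
    have es : p * (z.1 : ℝ) - q * z.2 = s z := rfl
    have et : q * (z.1 : ℝ) + p * z.2 = t z := rfl
    have hst : (z.1 : ℝ) ^ 2 + (z.2 : ℝ) ^ 2 = s z ^ 2 + t z ^ 2 := by
      rw [← es, ← et]
      linear_combination (-((z.1 : ℝ) ^ 2 + (z.2 : ℝ) ^ 2)) * hpq
    rw [es, et, show -p * (z.1 : ℝ) - -q * z.2 = -s z by rw [← es]; ring,
      show -q * (z.1 : ℝ) + -p * z.2 = -t z by rw [← et]; ring,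
      show q * (z.1 : ℝ) - -p * z.2 = t z by rw [← et]; ring,
      show -p * (z.1 : ℝ) + q * z.2 = -s z by rw [← es]; ring,
      show -q * (z.1 : ℝ) - p * z.2 = -t z by rw [← et]; ring,
      show p * (z.1 : ℝ) + -q * z.2 = s z by rw [← es]; ring]
    simp only [abs_neg]
    by_cases hsm : |s z| < 1 ∧ |t z| < 1
    · left
      have h1 : s z ^ 2 < 1 := (sq_lt_one_iff_abs_lt_one _).2 hsm.1
      have h2 : t z ^ 2 < 1 := (sq_lt_one_iff_abs_lt_one _).2 hsm.2
      have h3 : z.1 ^ 2 + z.2 ^ 2 < 2 := by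
        have : (z.1 : ℝ) ^ 2 + (z.2 : ℝ) ^ 2 < 2 := by linarith
        exact_mod_cast this
      simp only [Finset.mem_product, Finset.mem_Icc]
      refine ⟨⟨?_, ?_⟩, ?_, ?_⟩ <;> nlinarith [sq_nonneg z.1, sq_nonneg z.2]
    · right
      rw [not_and_or, not_lt, not_lt] at hsm
      rcases le_total |t z| |s z| with hle | hle
      · have h1 : 1 ≤ |s z| := hsm.elim id fun h => h.trans hle
        rcases le_total 0 (s z) with h0 | h0
        · rw [abs_of_nonneg h0] at h1 hle; exact Or.inl ⟨h1, hle⟩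
        · rw [abs_of_nonpos h0] at h1 hle; exact Or.inr (Or.inl ⟨h1, hle⟩)
      · have h1 : 1 ≤ |t z| := hsm.elim (fun h => h.trans hle) id
        rcases le_total 0 (t z) with h0 | h0
        · rw [abs_of_nonneg h0] at h1 hle; exact Or.inr (Or.inr (Or.inl ⟨h1, hle⟩))
        · rw [abs_of_nonpos h0] at h1 hle; exact Or.inr (Or.inr (Or.inr ⟨h1, hle⟩))
  have hc := Finset.card_le_card hsub
  have hc' := hc.trans <| (Finset.card_union_le _ _).trans <| Nat.add_le_add_left
    ((Finset.card_union_le _ _).trans <| Nat.add_le_add_left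
    ((Finset.card_union_le _ _).trans <| Nat.add_le_add_left (Finset.card_union_le _ _) _) _) _
  have hc'' : (T.card : ℝ) ≤ _ := Nat.cast_le.2 hc'
  push_cast at hc''
  linarith

section Bilinear

variable {G V : Type*}

theorem sum_mul_le_tsum_mul_tsum {ι : Type*} {J : Finset ι} {f : ι → G × G}
    (hf : Set.InjOn f J) {α β : G → ℝ} (hα : ∀ x, 0 ≤ α x) (hβ : ∀ x, 0 ≤ β x)
    (hαs : Summable α) (hβs : Summable β) :
    ∑ i ∈ J, α (f i).1 * β (f i).2 ≤ (∑' x, α x) * ∑' x, β x := by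
  classical
  have hs : Summable fun x : G × G => α x.1 * β x.2 := hαs.mul_of_nonneg hβs hα hβ
  rw [hαs.tsum_mul_tsum hβs hs, ← Finset.sum_image (f := fun x : G × G => α x.1 * β x.2) hf]
  exact hs.sum_le_tsum _ fun x _ => mul_nonneg (hα _) (hβ _)

variable [AddCommGroup G]

/-- The restriction to `S` of the convolution of `a` and `b`, at the point `c`. -/
def restrictedConv (a b : G → ℂ) (c : G) (S : Finset G) : ℂ := ∑ z ∈ S, a z * b (c - z)

theorem norm_restrictedConv_le (a b : G → ℂ) (c : G) (S : Finset G) :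
    ‖restrictedConv a b c S‖ ≤ ∑ z ∈ S, ‖a z‖ * ‖b (c - z)‖ := by
  simpa only [restrictedConv, norm_mul] using norm_sum_le S fun z => a z * b (c - z)

variable {a b : G → ℂ} (ha : Summable fun z => ‖a z‖ ^ 2) (hb : Summable fun z => ‖b z‖ ^ 2)

include ha hb

theorem norm_restrictedConv_sq_le (c : G) (S : Finset G) :
    ‖restrictedConv a b c S‖ ^ 2 ≤ (∑' z, ‖a z‖ ^ 2) * ∑' z, ‖b z‖ ^ 2 := by
  classical
  calc ‖restrictedConv a b c S‖ ^ 2 ≤ (∑ z ∈ S, ‖a z‖ * ‖b (c - z)‖) ^ 2 := by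
        gcongr; exact norm_restrictedConv_le a b c S
    _ ≤ (∑ z ∈ S, ‖a z‖ ^ 2) * ∑ z ∈ S, ‖b (c - z)‖ ^ 2 := Finset.sum_mul_sq_le_sq_mul_sq ..
    _ ≤ _ := by
      gcongr
      · exact ha.sum_le_tsum _ fun _ _ => by positivity
      · rw [← Finset.sum_image (f := fun z => ‖b z‖ ^ 2) (g := fun z => c - z)
          sub_right_injective.injOn]
        exact hb.sum_le_tsum _ fun _ _ => by positivity

/-- Bilinear estimate when each fibre has at most `N` points. -/
theorem sum_restrictedConv_le_of_card_le {N : ℝ} (hN : 0 ≤ N) (I : Finset V) (π : V → G)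
    (S : V → Finset G) (hcard : ∀ v ∈ I, ((S v).card : ℝ) ≤ N)
    (hS : ∀ v ∈ I, ∀ v' ∈ I, π v = π v' → ∀ z ∈ S v, z ∈ S v' → v = v') :
    ∑ v ∈ I, ‖restrictedConv a b (π v) (S v)‖ ^ 2
      ≤ N * ((∑' z, ‖a z‖ ^ 2) * ∑' z, ‖b z‖ ^ 2) := by
  have hv (v) (hv : v ∈ I) : ‖restrictedConv a b (π v) (S v)‖ ^ 2
      ≤ N * ∑ z ∈ S v, ‖a z‖ ^ 2 * ‖b (π v - z)‖ ^ 2 :=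
    calc _ ≤ (∑ z ∈ S v, ‖a z‖ * ‖b (π v - z)‖) ^ 2 := by
          gcongr; exact norm_restrictedConv_le a b _ _
      _ ≤ (S v).card * ∑ z ∈ S v, (‖a z‖ * ‖b (π v - z)‖) ^ 2 := sq_sum_le_card_mul_sum_sq
      _ ≤ _ := by
        simp only [mul_pow]
        exact mul_le_mul_of_nonneg_right (hcard v hv) (Finset.sum_nonneg fun _ _ => by positivity)
  refine (Finset.sum_le_sum hv).trans ?_
  rw [← Finset.mul_sum, Finset.sum_sigma']
  refine mul_le_mul_of_nonneg_left ?_ hN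
  refine sum_mul_le_tsum_mul_tsum (J := I.sigma S) (f := fun x => (x.2, π x.1 - x.2)) ?_
    (fun _ => by positivity) (fun _ => by positivity) ha hb
  rintro ⟨v, z⟩ hx ⟨v', z'⟩ hx' hxx
  simp only [Finset.coe_sigma, Set.mem_sigma_iff, Finset.mem_coe] at hx hx'
  simp only [Prod.mk.injEq] at hxx
  obtain ⟨rfl, h2⟩ := hxx
  obtain rfl := hS v hx.1 v' hx'.1 (sub_left_injective h2) z hx.2 hx'.2
  rfl

/-- Bilinear estimate when two different points `z`, `u` are such that `z` and `π v - u` belong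
to the fibre of at most one `v`. -/
theorem sum_restrictedConv_le_of_unique (I : Finset V) (π : V → G) (S : V → Finset G)
    (hπ : ∀ v ∈ I, ∀ v' ∈ I, π v = π v' → v = v')
    (huniq : ∀ v ∈ I, ∀ v' ∈ I, ∀ z u, z ≠ u → z ∈ S v → z ∈ S v' →
      π v - u ∈ S v → π v' - u ∈ S v' → v = v') :
    ∑ v ∈ I, ‖restrictedConv a b (π v) (S v)‖ ^ 2
      ≤ 2 * ((∑' z, ‖a z‖ ^ 2) * ∑' z, ‖b z‖ ^ 2) := by
  classical
  set M := (∑' z, ‖a z‖ ^ 2) * ∑' z, ‖b z‖ ^ 2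
  let J : Finset (Σ _ : V, G × G) := I.sigma fun v => S v ×ˢ S v
  let J₁ := J.filter fun x => x.2.1 + x.2.2 = π x.1
  let J₂ := J.filter fun x => ¬(x.2.1 + x.2.2 = π x.1)
  have hmem {x} : x ∈ J ↔ x.1 ∈ I ∧ x.2.1 ∈ S x.1 ∧ x.2.2 ∈ S x.1 := by
    simp [J]
  have bound (K : Finset (Σ _ : V, G × G)) (f : (Σ _ : V, G × G) → G × G) (hf : Set.InjOn f K) :
      ∑ x ∈ K, ‖a (f x).1‖ ^ 2 * ‖b (f x).2‖ ^ 2 ≤ M :=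
    sum_mul_le_tsum_mul_tsum hf (fun _ => by positivity) (fun _ => by positivity) ha hb
  have b₁ := bound J₁ (fun x => (x.2.1, π x.1 - x.2.1)) <| by
    rintro ⟨v, z, w⟩ hx ⟨v', z', w'⟩ hx' h
    obtain ⟨hJ, hsum⟩ := Finset.mem_filter.1 (Finset.mem_coe.1 hx)
    obtain ⟨hJ', hsum'⟩ := Finset.mem_filter.1 (Finset.mem_coe.1 hx')
    rw [hmem] at hJ hJ'
    simp only [Prod.mk.injEq] at h hsum hsum' hJ hJ'
    obtain ⟨rfl, h2⟩ := h
    obtain rfl := hπ v hJ.1 v' hJ'.1 (sub_left_injective h2)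
    obtain rfl := add_left_cancel (hsum.trans hsum'.symm)
    rfl
  have b₂ := bound J₁ (fun x => (x.2.2, π x.1 - x.2.2)) <| by
    rintro ⟨v, z, w⟩ hx ⟨v', z', w'⟩ hx' h
    obtain ⟨hJ, hsum⟩ := Finset.mem_filter.1 (Finset.mem_coe.1 hx)
    obtain ⟨hJ', hsum'⟩ := Finset.mem_filter.1 (Finset.mem_coe.1 hx')
    rw [hmem] at hJ hJ'
    simp only [Prod.mk.injEq] at h hsum hsum' hJ hJ'
    obtain ⟨rfl, h2⟩ := h
    obtain rfl := hπ v hJ.1 v' hJ'.1 (sub_left_injective h2)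
    obtain rfl := add_right_cancel (hsum.trans hsum'.symm)
    rfl
  have b₃ := bound J₂ (fun x => (x.2.1, π x.1 - x.2.2)) <| by
    rintro ⟨v, z, w⟩ hx ⟨v', z', w'⟩ hx' h
    obtain ⟨hJ, hsum⟩ := Finset.mem_filter.1 (Finset.mem_coe.1 hx)
    obtain ⟨hJ', hsum'⟩ := Finset.mem_filter.1 (Finset.mem_coe.1 hx')
    rw [hmem] at hJ hJ'
    simp only [Prod.mk.injEq] at h hsum hsum' hJ hJ'
    obtain ⟨rfl, h2⟩ := h
    obtain rfl := huniq v hJ.1 v' hJ'.1 z (π v - w) (fun h => hsum (eq_sub_iff_add_eq.1 h))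
      hJ.2.1 hJ'.2.1 (by rw [sub_sub_cancel]; exact hJ.2.2)
      (by rw [h2, sub_sub_cancel]; exact hJ'.2.2)
    obtain rfl := sub_right_injective h2
    rfl
  have b₄ := bound J₂ (fun x => (x.2.2, π x.1 - x.2.1)) <| by
    rintro ⟨v, z, w⟩ hx ⟨v', z', w'⟩ hx' h
    obtain ⟨hJ, hsum⟩ := Finset.mem_filter.1 (Finset.mem_coe.1 hx)
    obtain ⟨hJ', hsum'⟩ := Finset.mem_filter.1 (Finset.mem_coe.1 hx')
    rw [hmem] at hJ hJ'
    simp only [Prod.mk.injEq] at h hsum hsum' hJ hJ'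
    obtain ⟨rfl, h2⟩ := h
    obtain rfl := huniq v hJ.1 v' hJ'.1 w (π v - z)
      (fun h => hsum (by rw [add_comm]; exact eq_sub_iff_add_eq.1 h))
      hJ.2.2 hJ'.2.2 (by rw [sub_sub_cancel]; exact hJ.2.1)
      (by rw [h2, sub_sub_cancel]; exact hJ'.2.1)
    obtain rfl := sub_right_injective h2
    rfl
  let F : (Σ _ : V, G × G) → ℝ := fun x =>
    (‖a x.2.1‖ * ‖b (π x.1 - x.2.1)‖) * (‖a x.2.2‖ * ‖b (π x.1 - x.2.2)‖)
  have hF : ∑ v ∈ I, ‖restrictedConv a b (π v) (S v)‖ ^ 2 ≤ ∑ x ∈ J, F x := by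
    rw [Finset.sum_sigma]
    refine Finset.sum_le_sum fun v _ => ?_
    calc _ ≤ (∑ z ∈ S v, ‖a z‖ * ‖b (π v - z)‖) ^ 2 := by
          gcongr; exact norm_restrictedConv_le a b _ _
      _ = _ := by rw [sq, Finset.sum_mul_sum, Finset.sum_product]
  have h₁ : ∑ x ∈ J₁, F x ≤ M := by
    have : ∑ x ∈ J₁, F x ≤ ∑ x ∈ J₁, (1 / 2 * (‖a x.2.1‖ ^ 2 * ‖b (π x.1 - x.2.1)‖ ^ 2)
        + 1 / 2 * (‖a x.2.2‖ ^ 2 * ‖b (π x.1 - x.2.2)‖ ^ 2)) :=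
      Finset.sum_le_sum fun x _ => by
        have := sq_nonneg (‖a x.2.1‖ * ‖b (π x.1 - x.2.1)‖ - ‖a x.2.2‖ * ‖b (π x.1 - x.2.2)‖)
        simp only [F]
        linarith
    rw [Finset.sum_add_distrib, ← Finset.mul_sum, ← Finset.mul_sum] at this
    linarith
  have h₂ : ∑ x ∈ J₂, F x ≤ M := by
    have : ∑ x ∈ J₂, F x ≤ ∑ x ∈ J₂, (1 / 2 * (‖a x.2.1‖ ^ 2 * ‖b (π x.1 - x.2.2)‖ ^ 2)
        + 1 / 2 * (‖a x.2.2‖ ^ 2 * ‖b (π x.1 - x.2.1)‖ ^ 2)) :=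
      Finset.sum_le_sum fun x _ => by
        have := sq_nonneg (‖a x.2.1‖ * ‖b (π x.1 - x.2.2)‖ - ‖a x.2.2‖ * ‖b (π x.1 - x.2.1)‖)
        simp only [F]
        linarith
    rw [Finset.sum_add_distrib, ← Finset.mul_sum, ← Finset.mul_sum] at this
    linarith
  have hsplit := Finset.sum_filter_add_sum_filter_not J (fun x => x.2.1 + x.2.2 = π x.1) F
  linarith

end Bilinear

theorem int_eq_zero_of_sq_eq_three_mul_sq {m n : ℤ} (h : m ^ 2 = 3 * n ^ 2) : m = 0 := by
  by_contra hm
  have hn : n ≠ 0 := by rintro rfl; exact hm (by simpa using h)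
  have hn' : (n : ℝ) ≠ 0 := Int.cast_ne_zero.2 hn
  have h3 : (3 : ℝ) = ((m : ℝ) / n) ^ 2 := by
    rw [div_pow, eq_div_iff (by positivity)]; exact_mod_cast h.symm
  have hirr : Irrational (Real.sqrt 3) := by exact_mod_cast Nat.prime_three.irrational_sqrt
  apply hirr
  rw [h3, Real.sqrt_sq_eq_abs]
  exact ⟨|(m : ℚ) / n|, by push_cast; rfl⟩

/-- Four times the phase of `z` and `w - z`, after completing the square: it equals
`phiZ w + 3 * Re (w * (2 z - w) ^ 2)`, and this is the last real part. -/
def resonance (w z : ℤ × ℤ) : ℤ :=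
  w.1 * ((2 * z.1 - w.1) ^ 2 - (2 * z.2 - w.2) ^ 2)
    - 2 * w.2 * ((2 * z.1 - w.1) * (2 * z.2 - w.2))

theorem four_mul_phiZ_add_phiZ (w z : ℤ × ℤ) :
    4 * (phiZ z.1 z.2 + phiZ (w.1 - z.1) (w.2 - z.2)) = phiZ w.1 w.2 + 3 * resonance w z := by
  simp only [phiZ, resonance]; ring

/-- A chord of a degenerate resonance set is orthogonal to the resonance condition. -/
theorem eq_zero_of_resonance_eq_zero {w z u : ℤ × ℤ} (hz : resonance w z = 0)
    (hu : resonance w (w - u) = 0)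
    (hcross : (2 * z.1 - w.1) * (2 * (w - u).2 - w.2)
      = (2 * z.2 - w.2) * (2 * (w - u).1 - w.1)) :
    w.1 * ((z.1 - u.1) ^ 2 - (z.2 - u.2) ^ 2) - 2 * w.2 * ((z.1 - u.1) * (z.2 - u.2)) = 0 ∧
      (2 * z.1 - w.1) * (z.2 - u.2) = (2 * z.2 - w.2) * (z.1 - u.1) := by
  obtain ⟨ξ, η⟩ := w
  obtain ⟨z₁, z₂⟩ := z
  obtain ⟨u₁, u₂⟩ := u
  simp only [resonance, Prod.fst_sub, Prod.snd_sub] at *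
  refine ⟨?_, by linarith⟩
  have hmix : ξ * ((2 * z₁ - ξ) * (2 * (ξ - u₁) - ξ) - (2 * z₂ - η) * (2 * (η - u₂) - η))
      - η * ((2 * z₁ - ξ) * (2 * (η - u₂) - η) + (2 * z₂ - η) * (2 * (ξ - u₁) - ξ)) = 0 := by
    by_cases hx : 2 * z₁ - ξ = 0
    · by_cases hy : 2 * z₂ - η = 0
      · rw [hx, hy]; ring
      · apply (mul_eq_zero_iff_left hy).1
        linear_combination (2 * (η - u₂) - η) * hz + (-ξ * (2 * z₁ - ξ) + η * (2 * z₂ - η)) * hcross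
    · apply (mul_eq_zero_iff_left hx).1
      linear_combination (2 * (ξ - u₁) - ξ) * hz + (-ξ * (2 * z₂ - η) - η * (2 * z₁ - ξ)) * hcross
  have : 4 * (ξ * ((z₁ - u₁) ^ 2 - (z₂ - u₂) ^ 2) - 2 * η * ((z₁ - u₁) * (z₂ - u₂))) = 0 := by
    linear_combination hz + hu + 2 * hmix
  linarith

theorem eq_of_resonance_eq_zero {w w' z u : ℤ × ℤ} (hzu : z ≠ u)
    (hz : resonance w z = 0) (hu : resonance w (w - u) = 0)
    (hcross : (2 * z.1 - w.1) * (2 * (w - u).2 - w.2)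
      = (2 * z.2 - w.2) * (2 * (w - u).1 - w.1))
    (hex : ¬(w.1 = 0 ∧ z.1 = 0))
    (hz' : resonance w' z = 0) (hu' : resonance w' (w' - u) = 0)
    (hcross' : (2 * z.1 - w'.1) * (2 * (w' - u).2 - w'.2)
      = (2 * z.2 - w'.2) * (2 * (w' - u).1 - w'.1)) : w = w' := by
  obtain ⟨h1, h2⟩ := eq_zero_of_resonance_eq_zero hz hu hcross
  obtain ⟨h1', h2'⟩ := eq_zero_of_resonance_eq_zero hz' hu' hcross'
  by_cases hd : z.1 - u.1 = 0
  · have hd2 : z.2 - u.2 ≠ 0 := fun h => hzu (Prod.ext (sub_eq_zero.1 hd) (sub_eq_zero.1 h))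
    rw [hd] at h1 h2
    have hw : w.1 = 0 := by
      have : w.1 * (z.2 - u.2) ^ 2 = 0 := by linear_combination -h1
      simpa [hd2] using this
    have hzz : 2 * z.1 - w.1 = 0 := by
      have : (2 * z.1 - w.1) * (z.2 - u.2) = 0 := by linear_combination h2
      simpa [hd2] using this
    exact absurd ⟨hw, by omega⟩ hex
  · have e1 : (w.1 - w'.1) * ((z.1 - u.1) ^ 2 - 3 * (z.2 - u.2) ^ 2) = 0 := by
      linear_combination h1 - h1' + 2 * (z.2 - u.2) * (h2 - h2')
    have hne : (z.1 - u.1) ^ 2 - 3 * (z.2 - u.2) ^ 2 ≠ 0 := fun h =>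
      hd (int_eq_zero_of_sq_eq_three_mul_sq (sub_eq_zero.1 h))
    have e2 : w.1 - w'.1 = 0 := (mul_eq_zero.1 e1).resolve_right hne
    have e3 : (w.2 - w'.2) * (z.1 - u.1) = 0 := by
      linear_combination h2 - h2' + (z.2 - u.2) * e2
    have e4 := (mul_eq_zero.1 e3).resolve_right hd
    exact Prod.ext (sub_eq_zero.1 e2) (sub_eq_zero.1 e4)

theorem exists_asymptotic_coordinates_resonance {w : ℤ × ℤ} (hw : w ≠ 0) :
    ∃ p q ρ : ℝ, ρ ≠ 0 ∧ p ^ 2 + q ^ 2 = 1 ∧ ∀ z : ℤ × ℤ,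
      (p * ((2 * z.1 - w.1 : ℤ) : ℝ) - q * ((2 * z.2 - w.2 : ℤ) : ℝ)) *
        (q * ((2 * z.1 - w.1 : ℤ) : ℝ) + p * ((2 * z.2 - w.2 : ℤ) : ℝ)) = ρ * resonance w z := by
  obtain ⟨p, q, ρ, hρ, hpq, h⟩ := exists_asymptotic_coordinates (ξ := w.1) (η := w.2)
    (fun h => hw (Prod.ext (by exact_mod_cast h.1) (by exact_mod_cast h.2)))
  refine ⟨p, q, ρ, hρ, hpq, fun z => ?_⟩
  rw [h]
  simp only [resonance]
  push_cast
  ring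

/-- A degenerate resonance set is the union of two lines through `w / 2`, distinguished by `P`. -/
theorem exists_line_splitting (w : ℤ × ℤ) : ∃ P : ℤ × ℤ → Prop, w ≠ 0 → ∀ z z' : ℤ × ℤ,
    resonance w z = 0 → resonance w z' = 0 → (P z ↔ P z') →
      (2 * z.1 - w.1) * (2 * z'.2 - w.2) = (2 * z.2 - w.2) * (2 * z'.1 - w.1) := by
  by_cases hw : w = 0
  · exact ⟨fun _ => True, fun h => absurd hw h⟩
  obtain ⟨p, q, ρ, hρ, hpq, h⟩ := exists_asymptotic_coordinates_resonance hw
  refine ⟨fun z => p * ((2 * z.1 - w.1 : ℤ) : ℝ) - q * ((2 * z.2 - w.2 : ℤ) : ℝ) = 0,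
    fun _ z z' hz hz' hP => ?_⟩
  have e := h z
  have e' := h z'
  beta_reduce at hP
  rw [hz, Int.cast_zero, mul_zero] at e
  rw [hz', Int.cast_zero, mul_zero] at e'
  have : ((2 * z.1 - w.1 : ℤ) : ℝ) * ((2 * z'.2 - w.2 : ℤ) : ℝ)
      = ((2 * z.2 - w.2 : ℤ) : ℝ) * ((2 * z'.1 - w.1 : ℤ) : ℝ) := by
    generalize ((2 * z.1 - w.1 : ℤ) : ℝ) = x at *
    generalize ((2 * z.2 - w.2 : ℤ) : ℝ) = y at *
    generalize ((2 * z'.1 - w.1 : ℤ) : ℝ) = x' at *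
    generalize ((2 * z'.2 - w.2 : ℤ) : ℝ) = y' at *
    by_cases hs : p * x - q * y = 0
    · have hs' := hP.1 hs
      linear_combination (p * y' + q * x') * hs - (p * y + q * x) * hs'
        - (x * y' - y * x') * hpq
    · have ht := (mul_eq_zero.1 e).resolve_left hs
      have ht' := (mul_eq_zero.1 e').resolve_left (fun h => hs (hP.2 h))
      linear_combination (q * y' - p * x') * ht - (q * y - p * x) * ht'
        - (x * y' - y * x') * hpq
  exact_mod_cast this

theorem card_resonance_le {R : ℝ} (hR : 0 ≤ R) (p : ℝ × ℝ) {w : ℤ × ℤ} (hw : w ≠ 0)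
    {k : ℤ} (hk : k ≠ 0) (S : Finset (ℤ × ℤ)) (hS : ∀ z ∈ S, resonance w z = k)
    (hdisk : ∀ z ∈ S, ((z.1 : ℝ) - p.1) ^ 2 + ((z.2 : ℝ) - p.2) ^ 2 ≤ R ^ 2) :
    (S.card : ℝ) ≤ 64 * (4 * R) ^ (3 / 5 : ℝ) + 41 := by
  classical
  obtain ⟨s, t, ρ, hρ, hst, h⟩ := exists_asymptotic_coordinates_resonance hw
  let g : ℤ × ℤ → ℤ × ℤ := fun z => (2 * z.1 - w.1, 2 * z.2 - w.2)
  have hg : Function.Injective g := fun z z' hzz => by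
    simp only [g, Prod.mk.injEq] at hzz
    exact Prod.ext (by omega) (by omega)
  rw [← Finset.card_image_of_injective S hg]
  refine card_hyperbola_le hst (κ := ρ * k) (mul_ne_zero hρ (Int.cast_ne_zero.2 hk))
    (by positivity) _ ?_ ?_
  · intro y hy
    obtain ⟨z, hz, rfl⟩ := Finset.mem_image.1 hy
    rw [← hS z hz, ← h z]
  · intro y hy y' hy'
    obtain ⟨z, hz, rfl⟩ := Finset.mem_image.1 hy
    obtain ⟨z', hz', rfl⟩ := Finset.mem_image.1 hy'
    have d := hdisk z hz
    have d' := hdisk z' hz'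
    simp only [g]
    push_cast
    nlinarith [sq_nonneg (((z.1 : ℝ) - p.1) + (z'.1 - p.1)),
      sq_nonneg (((z.2 : ℝ) - p.2) + (z'.2 - p.2))]

/-- The interactions that are summed at the space-time frequency `v`. -/
def interactions (A : Finset (ℤ × ℤ)) (v : (ℤ × ℤ) × ℤ) : Finset (ℤ × ℤ) :=
  A.filter fun w => v.2 = phiZ w.1 w.2 + phiZ (v.1.1 - w.1) (v.1.2 - w.2) ∧
    ¬(v.1.1 = 0 ∧ w.1 = 0)

theorem resonance_of_mem_interactions {A : Finset (ℤ × ℤ)} {v : (ℤ × ℤ) × ℤ} {z : ℤ × ℤ}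
    (hz : z ∈ interactions A v) : 3 * resonance v.1 z = 4 * v.2 - phiZ v.1.1 v.1.2 := by
  have h := four_mul_phiZ_add_phiZ v.1 z
  rw [← (Finset.mem_filter.1 hz).2.1] at h
  linarith

section Interactions

variable {a b : ℤ × ℤ → ℂ} (ha : Summable fun z => ‖a z‖ ^ 2)
  (hb : Summable fun z => ‖b z‖ ^ 2) (A : Finset (ℤ × ℤ)) (I : Finset ((ℤ × ℤ) × ℤ))

include ha hb

theorem sum_interactions_nondegenerate_le {R : ℝ} (hR : 0 ≤ R) (p : ℝ × ℝ)
    (hdisk : ∀ z ∈ A, ((z.1 : ℝ) - p.1) ^ 2 + ((z.2 : ℝ) - p.2) ^ 2 ≤ R ^ 2)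
    (hI : ∀ v ∈ I, 4 * v.2 ≠ phiZ v.1.1 v.1.2) :
    ∑ v ∈ I, ‖restrictedConv a b v.1 (interactions A v)‖ ^ 2
      ≤ (64 * (4 * R) ^ (3 / 5 : ℝ) + 41) * ((∑' z, ‖a z‖ ^ 2) * ∑' z, ‖b z‖ ^ 2) := by
  refine sum_restrictedConv_le_of_card_le ha hb (by positivity) I (fun v => v.1) _
    (fun v hv => ?_) fun v _ v' _ hvv z hz hz' => ?_
  · rcases (interactions A v).eq_empty_or_nonempty with hS | ⟨z₀, hz₀⟩
    · rw [hS, Finset.card_empty, Nat.cast_zero]; positivity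
    · have h₀ := resonance_of_mem_interactions hz₀
      have hk : resonance v.1 z₀ ≠ 0 := fun h => hI v hv (by rw [h] at h₀; linarith)
      refine card_resonance_le hR p (w := v.1) ?_ hk _ (fun z hz => ?_)
        fun z hz => hdisk z (Finset.mem_filter.1 hz).1
      · intro hw
        apply hk
        simp [resonance, hw]
      · have := resonance_of_mem_interactions hz
        omega
  · refine Prod.ext hvv ?_
    rw [(Finset.mem_filter.1 hz).2.1, (Finset.mem_filter.1 hz').2.1, hvv]

theorem sum_interactions_degenerate_le (hI : ∀ v ∈ I, 4 * v.2 = phiZ v.1.1 v.1.2)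
    (hI0 : ∀ v ∈ I, v.1 ≠ 0) :
    ∑ v ∈ I, ‖restrictedConv a b v.1 (interactions A v)‖ ^ 2
      ≤ 8 * ((∑' z, ‖a z‖ ^ 2) * ∑' z, ‖b z‖ ^ 2) := by
  classical
  choose P hP using exists_line_splitting
  have key (Q : ℤ × ℤ → ℤ × ℤ → Prop) [∀ w, DecidablePred (Q w)]
      (hQ : ∀ w z z', Q w z → Q w z' → (P w z ↔ P w z')) :
      ∑ v ∈ I, ‖restrictedConv a b v.1 ((interactions A v).filter (Q v.1))‖ ^ 2
        ≤ 2 * ((∑' z, ‖a z‖ ^ 2) * ∑' z, ‖b z‖ ^ 2) := by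
    refine sum_restrictedConv_le_of_unique ha hb I (fun v => v.1) _ ?_ ?_
    · intro v hv v' hv' h
      have h1 := hI v hv
      have h2 := hI v' hv'
      rw [h] at h1
      exact Prod.ext h (by omega)
    · intro v hv v' hv' z u hzu hz hz' hu hu'
      have hres (v) (hv : v ∈ I) (z) (hz : z ∈ (interactions A v).filter (Q v.1)) :
          resonance v.1 z = 0 := by
        have := resonance_of_mem_interactions (Finset.mem_filter.1 hz).1
        have := hI v hv
        omega
      have hcross (v) (hv : v ∈ I) (hz : z ∈ (interactions A v).filter (Q v.1))
          (hu : v.1 - u ∈ (interactions A v).filter (Q v.1)) :=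
        hP v.1 (hI0 v hv) z (v.1 - u) (hres v hv z hz) (hres v hv _ hu)
          (hQ _ _ _ (Finset.mem_filter.1 hz).2 (Finset.mem_filter.1 hu).2)
      have hvv : v.1 = v'.1 := eq_of_resonance_eq_zero hzu (hres v hv z hz) (hres v hv _ hu)
        (hcross v hv hz hu) (Finset.mem_filter.1 (Finset.mem_filter.1 hz).1).2.2
        (hres v' hv' z hz') (hres v' hv' _ hu') (hcross v' hv' hz' hu')
      have h1 := hI v hv
      have h2 := hI v' hv'
      rw [hvv] at h1
      exact Prod.ext hvv (by omega)
  have k₁ := key P fun w z z' h h' => ⟨fun _ => h', fun _ => h⟩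
  have k₂ := key (fun w z => ¬P w z) fun w z z' h h' =>
    ⟨fun hh => absurd hh h, fun hh => absurd hh h'⟩
  calc _ ≤ ∑ v ∈ I, (2 * ‖restrictedConv a b v.1 ((interactions A v).filter (P v.1))‖ ^ 2
        + 2 * ‖restrictedConv a b v.1 ((interactions A v).filter fun z => ¬P v.1 z)‖ ^ 2) := by
        refine Finset.sum_le_sum fun v _ => ?_
        have hsplit : restrictedConv a b v.1 (interactions A v)
            = restrictedConv a b v.1 ((interactions A v).filter (P v.1))
              + restrictedConv a b v.1 ((interactions A v).filter fun z => ¬P v.1 z) :=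
          (Finset.sum_filter_add_sum_filter_not _ _ _).symm
        rw [hsplit, ← mul_add]
        exact (pow_le_pow_left₀ (norm_nonneg _) (norm_add_le _ _) 2).trans (add_sq_le ..)
    _ ≤ _ := by
      rw [Finset.sum_add_distrib, ← Finset.mul_sum, ← Finset.mul_sum]
      linarith

theorem sum_interactions_le {R : ℝ} (hR : 0 ≤ R) (p : ℝ × ℝ)
    (hdisk : ∀ z ∈ A, ((z.1 : ℝ) - p.1) ^ 2 + ((z.2 : ℝ) - p.2) ^ 2 ≤ R ^ 2) :
    ∑ v ∈ I, ‖restrictedConv a b v.1 (interactions A v)‖ ^ 2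
      ≤ (64 * (4 * R) ^ (3 / 5 : ℝ) + 50) * ((∑' z, ‖a z‖ ^ 2) * ∑' z, ‖b z‖ ^ 2) := by
  have h₁ := sum_interactions_nondegenerate_le ha hb A
    (I.filter fun v => ¬(4 * v.2 = phiZ v.1.1 v.1.2)) hR p hdisk
    fun v hv => (Finset.mem_filter.1 hv).2
  let J := I.filter fun v => 4 * v.2 = phiZ v.1.1 v.1.2
  have hJ (v) (hv : v ∈ J) : 4 * v.2 = phiZ v.1.1 v.1.2 := (Finset.mem_filter.1 hv).2
  have h₂ := sum_interactions_degenerate_le ha hb A (J.filter fun v => ¬(v.1 = 0))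
    (fun v hv => hJ v (Finset.mem_filter.1 hv).1) fun v hv => (Finset.mem_filter.1 hv).2
  have h₃ : ∑ v ∈ J.filter (fun v => v.1 = 0), ‖restrictedConv a b v.1 (interactions A v)‖ ^ 2
      ≤ (∑' z, ‖a z‖ ^ 2) * ∑' z, ‖b z‖ ^ 2 := by
    have hsub : J.filter (fun v => v.1 = 0) ⊆ {0} := by
      intro v hv
      obtain ⟨hv, hv0⟩ := Finset.mem_filter.1 hv
      have h := hJ v hv
      have h0 : v.2 = 0 := by simpa [hv0, phiZ] using h
      exact Finset.mem_singleton.2 (Prod.ext hv0 h0)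
    refine (Finset.sum_le_sum_of_subset_of_nonneg hsub fun _ _ _ => by positivity).trans ?_
    rw [Finset.sum_singleton]
    exact norm_restrictedConv_sq_le ha hb _ _
  have s₁ := Finset.sum_filter_add_sum_filter_not I (fun v => 4 * v.2 = phiZ v.1.1 v.1.2)
    fun v => ‖restrictedConv a b v.1 (interactions A v)‖ ^ 2
  have s₂ := Finset.sum_filter_add_sum_filter_not J (fun v => v.1 = 0)
    fun v => ‖restrictedConv a b v.1 (interactions A v)‖ ^ 2
  linarith

end Interactions

theorem four_mul_rpow_le {R ε : ℝ} (hR : 1 ≤ R) (hε : 0 ≤ ε) :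
    64 * (4 * R) ^ (3 / 5 : ℝ) + 50 ≤ 306 * R ^ ((3 : ℝ) / 5 + ε) := by
  have h1 : (4 : ℝ) ^ (3 / 5 : ℝ) ≤ 4 := Real.rpow_le_self_of_one_le (by norm_num) (by norm_num)
  have h2 : R ^ (3 / 5 : ℝ) ≤ R ^ ((3 : ℝ) / 5 + ε) :=
    Real.rpow_le_rpow_of_exponent_le hR (by linarith)
  have h3 : 1 ≤ R ^ (3 / 5 : ℝ) := Real.one_le_rpow hR (by norm_num)
  rw [Real.mul_rpow (by norm_num) (by linarith)]
  nlinarith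

/-- Fourier-side formulation of the periodic bilinear Strichartz-type estimate with
exponent `γ = 3/5`: for finitely supported `a, b : ℤ² → ℂ` with `a` supported in a disk
of radius `R`, the `ℓ²`-norm (over `(ξ,η,τ) ∈ ℤ³`) of the convolution of `a` and `b`
restricted to the resonance surface `τ = φ(ξ₁,η₁) + φ(ξ−ξ₁,η−η₁)`, omitting the
interactions with `ξ = ξ₁ = 0`, is controlled by `R^(3/10+)` times the product of the
`ℓ²`-norms of `a` and `b`. -/
theorem periodic_bilinear_strichartz :
    ∀ ε > (0 : ℝ), ∃ C > (0 : ℝ), ∀ R : ℝ, 1 ≤ R → ∀ p : ℝ × ℝ, ∀ a b : ℤ × ℤ → ℂ,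
      (Function.support a).Finite → (Function.support b).Finite →
      (∀ q : ℤ × ℤ, a q ≠ 0 →
        Real.sqrt (((q.1 : ℝ) - p.1) ^ 2 + ((q.2 : ℝ) - p.2) ^ 2) ≤ R) →
      ∑' v : (ℤ × ℤ) × ℤ,
          ‖∑' w : ℤ × ℤ,
              (if v.2 = phiZ w.1 w.2 + phiZ (v.1.1 - w.1) (v.1.2 - w.2) ∧
                  ¬(v.1.1 = 0 ∧ w.1 = 0) then
                a w * b (v.1.1 - w.1, v.1.2 - w.2) else 0)‖ ^ 2
        ≤ C * R ^ ((3 : ℝ) / 5 + ε) * (∑' w : ℤ × ℤ, ‖a w‖ ^ 2)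
            * (∑' w : ℤ × ℤ, ‖b w‖ ^ 2) := by
  intro ε hε
  refine ⟨306, by norm_num, fun R hR p a b hfa hfb hdisk => ?_⟩
  have ha : Summable fun z => ‖a z‖ ^ 2 :=
    summable_of_hasFiniteSupport (hfa.subset fun z hz => by simpa using hz)
  have hb : Summable fun z => ‖b z‖ ^ 2 :=
    summable_of_hasFiniteSupport (hfb.subset fun z hz => by simpa using hz)
  have hA (z) (hz : z ∈ hfa.toFinset) :
      ((z.1 : ℝ) - p.1) ^ 2 + ((z.2 : ℝ) - p.2) ^ 2 ≤ R ^ 2 :=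
    (Real.sqrt_le_left (by linarith)).1 (hdisk z (by simpa using hz))
  have hinner (v : (ℤ × ℤ) × ℤ) : ∑' w : ℤ × ℤ,
      (if v.2 = phiZ w.1 w.2 + phiZ (v.1.1 - w.1) (v.1.2 - w.2) ∧ ¬(v.1.1 = 0 ∧ w.1 = 0) then
        a w * b (v.1.1 - w.1, v.1.2 - w.2) else 0)
      = restrictedConv a b v.1 (interactions hfa.toFinset v) := by
    rw [tsum_eq_sum (s := hfa.toFinset), restrictedConv, interactions, Finset.sum_filter]
    · rfl
    · intro z hz
      have : a z = 0 := by simpa using hz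
      simp [this]
  have hM : 0 ≤ (∑' z, ‖a z‖ ^ 2) * ∑' z, ‖b z‖ ^ 2 :=
    mul_nonneg (tsum_nonneg fun _ => by positivity) (tsum_nonneg fun _ => by positivity)
  simp only [hinner]
  rw [mul_assoc]
  refine Real.tsum_le_of_sum_le (fun _ => by positivity) fun I => ?_
  exact (sum_interactions_le ha hb _ I (by linarith) p hA).trans
    (mul_le_mul_of_nonneg_right (four_mul_rpow_le hR hε.le) hM)
end
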